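/- arXiv:1702.08599 — 2 statements merged into one kernel-verified Lean document; each statement's English description precedes it below -/
import Mathlib

section
/- Let r be a positive integer and let p be a prime with p > 5. Then 4·σ_4^{(1)}(2p^r, p) + 3·σ_4^{(2)}(2p^r, p) ≡ 0 (mod p^r). -/
open Finset

attribute [local instance] Classical.propDecidable

/-- `x ≡ y (mod p^s)` for rational numbers `x, y`: the `p`-adic valuation of `x - y`
is at least `s` (where the valuation of `0` is regarded as `+∞`). -/
def padicCong (p s : ℕ) (x y : ℚ) : Prop :=
  x = y ∨ (s : ℤ) ≤ padicValRat p (x - y)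

/-- `Z_n(N,p)`: the sum of `1/(l₁⋯lₙ)` over all ordered `n`-tuples `(l₁,…,lₙ)` of
positive integers not divisible by `p` with `l₁+⋯+lₙ = N`. -/
noncomputable def Zsum (p n N : ℕ) : ℚ :=
  ∑ l ∈ (Finset.Nat.antidiagonalTuple n N).filter
      (fun l => ∀ i, 0 < l i ∧ ¬ p ∣ l i),
    ∏ i, (l i : ℚ)⁻¹

/-- `S_n^{(m)}(p^r)`: the sum of `1/(l₁⋯lₙ)` over all ordered `n`-tuples `(l₁,…,lₙ)` of
positive integers not divisible by `p`, each `< p^r`, with `l₁+⋯+lₙ = m·p^r`. -/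
noncomputable def Ssum (p n m r : ℕ) : ℚ :=
  ∑ l ∈ (Finset.Nat.antidiagonalTuple n (m * p ^ r)).filter
      (fun l => ∀ i, (0 < l i ∧ ¬ p ∣ l i) ∧ l i < p ^ r),
    ∏ i, (l i : ℚ)⁻¹

/-- `σ_n^{(b)}(N,p)`: the sum of `(-1)^(l₁+⋯+l_b)/(l₁⋯lₙ)` over all ordered `n`-tuples
`(l₁,…,lₙ)` of positive integers not divisible by `p` with `l₁+⋯+lₙ = N`. -/
noncomputable def sigmaSum (p n b N : ℕ) : ℚ :=
  ∑ l ∈ (Finset.Nat.antidiagonalTuple n N).filter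
      (fun l => ∀ i, 0 < l i ∧ ¬ p ∣ l i),
    (-1 : ℚ) ^ (∑ i ∈ univ.filter (fun i : Fin n => (i : ℕ) < b), l i) *
      ∏ i, (l i : ℚ)⁻¹

/-- The value of a finite tuple at position `j`, extended by `0`. -/
noncomputable def seqAt {k : ℕ} (u : Fin k → ℕ) (j : ℕ) : ℕ :=
  if h : j < k then u ⟨j, h⟩ else 0

/-- The chain `i₁, i₂, …, i_d, l₁+⋯+l_a` (indexed from `0`): position `j < d` gives
`i_{j+1}` and position `d` (or beyond) gives `l₁+⋯+l_a`. -/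
noncomputable def Fchain {d a : ℕ} (i : Fin d → ℕ) (l : Fin a → ℕ) : ℕ → ℕ :=
  fun j => if h : j < d then i ⟨j, h⟩ else ∑ k, l k

/-- The summation conditions for `F_a^{(b)}(s,N,p)`:
`N > i₁ > ⋯ > i_d > l₁+⋯+l_a`, each `l_k ∈ 𝒫_p`, and
`i₁, i₁-i₂, …, i_{d-1}-i_d, i_d-(l₁+⋯+l_a) ∈ 𝒫_p`.
(When `d = 0` this reduces to `l₁+⋯+l_a < N` and each `l_k ∈ 𝒫_p`.) -/
def FCond (p : ℕ) {d a : ℕ} (i : Fin d → ℕ) (l : Fin a → ℕ) (N : ℕ) : Prop :=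
  (∀ k, 0 < l k ∧ ¬ p ∣ l k) ∧
  Fchain i l 0 < N ∧
  (0 < d → 0 < Fchain i l 0 ∧ ¬ p ∣ Fchain i l 0) ∧
  ∀ j < d, Fchain i l (j + 1) < Fchain i l j ∧
    0 < Fchain i l j - Fchain i l (j + 1) ∧ ¬ p ∣ (Fchain i l j - Fchain i l (j + 1))

/-- `F_a^{(b)}(s,N,p)` where `s = (s₁,…,s_d)` is a vector of signs. -/
noncomputable def Fsum (p a b : ℕ) {d : ℕ} (s : Fin d → ℤ) (N : ℕ) : ℚ :=
  ∑ il ∈ ((Fintype.piFinset fun _ : Fin d => Finset.range N) ×ˢ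
          (Fintype.piFinset fun _ : Fin a => Finset.range N)).filter
      (fun il => FCond p il.1 il.2 N),
    (∏ j, (s j : ℚ) ^ il.1 j) *
      (-1 : ℚ) ^ (∑ k ∈ univ.filter (fun k : Fin a => (k : ℕ) < b), il.2 k) /
      ((∏ j, (il.1 j : ℚ)) * ∏ k, (il.2 k : ℚ))

/-- `A_s`: the total size of the odd-indexed blocks in the decomposition
`s = (X_{w₁}, Z_{w₂}, …, Z_{w_l})`; equivalently, the number of positions `j` such that
the number of `-1`-entries among `s₁,…,s_j` is even. -/
noncomputable def Acount {d : ℕ} (s : Fin d → ℤ) : ℕ :=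
  (univ.filter fun j : Fin d =>
    Even (univ.filter (fun k : Fin d => k ≤ j ∧ s k = -1)).card).card

/-- `B_s`: the total size of the even-indexed blocks in the decomposition
`s = (X_{w₁}, Z_{w₂}, …, Z_{w_l})`; equivalently, the number of positions `j` such that
the number of `-1`-entries among `s₁,…,s_j` is odd. -/
noncomputable def Bcount {d : ℕ} (s : Fin d → ℤ) : ℕ :=
  (univ.filter fun j : Fin d =>
    Odd (univ.filter (fun k : Fin d => k ≤ j ∧ s k = -1)).card).card

/-- `len(W_s)`: the number of blocks, namely `1` plus the number of `-1`-entries of `s`. -/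
noncomputable def lenW {d : ℕ} (s : Fin d → ℤ) : ℕ :=
  1 + (univ.filter fun k : Fin d => s k = -1).card

/-- `P_s` (for given `a ≥ b`): `a - b - A_s` if `len(W_s)` is even, `b - B_s` if odd.
For `s = ∅` this gives `P_∅ = b`. -/
noncomputable def Pval (a b : ℕ) {d : ℕ} (s : Fin d → ℤ) : ℕ :=
  if 2 ∣ lenW s then a - b - Acount s else b - Bcount s

/-- `C_{a,b}(A,B)`, defined via falling factorials `(x)_γ = x(x-1)⋯(x-γ+1)`. -/
def Cab (a b A B : ℕ) : ℚ :=
  if A = 0 ∧ B = 0 then 1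
  else if A = 0 then (b.descFactorial B : ℚ)
  else if B = 0 then ((a - b).descFactorial A : ℚ)
  else ((a - b).descFactorial A : ℚ) * (b.descFactorial B : ℚ)


/-- The section of a power series along multiples of `q`. -/
noncomputable def secT {R : Type*} [CommRing R] (q : ℕ) (a : PowerSeries R) : PowerSeries R :=
  PowerSeries.mk fun m => PowerSeries.coeff (m * q) a

theorem coeff_secT {R : Type*} [CommRing R] (q : ℕ) (a : PowerSeries R) (m : ℕ) :
    PowerSeries.coeff m (secT q a) = PowerSeries.coeff (m * q) a := by
  simp [secT]

theorem secT_mul_one_sub {R : Type*} [CommRing R] (q : ℕ) (hq : 0 < q) (a : PowerSeries R) :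
    secT q (a * (1 - PowerSeries.X ^ q)) = secT q a * (1 - PowerSeries.X) := by
  ext m
  rw [coeff_secT, mul_sub, mul_sub, mul_one, mul_one, map_sub, map_sub, coeff_secT,
    PowerSeries.coeff_mul_X_pow']
  cases m with
  | zero =>
    have : ¬ q ≤ 0 := by omega
    simp [this]
  | succ k =>
    have : q ≤ (k + 1) * q := Nat.le_mul_of_pos_left _ (by omega)
    rw [if_pos this, PowerSeries.coeff_succ_mul_X, coeff_secT]
    congr 3
    rw [add_mul]; omega

theorem secT_mul_one_sub_pow {R : Type*} [CommRing R] (q : ℕ) (hq : 0 < q) (n : ℕ)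
    (a : PowerSeries R) :
    secT q (a * (1 - PowerSeries.X ^ q) ^ n) = secT q a * (1 - PowerSeries.X) ^ n := by
  induction n with
  | zero => simp
  | succ n ih => rw [pow_succ, ← mul_assoc, secT_mul_one_sub q hq, ih, pow_succ, mul_assoc]

theorem C_dvd_iff_coeff {R : Type*} [CommRing R] (c : R) (a : PowerSeries R) :
    PowerSeries.C c ∣ a ↔ ∀ n, c ∣ PowerSeries.coeff n a := by
  constructor
  · rintro ⟨b, rfl⟩ n
    simp
  · intro h
    choose g hg using h
    refine ⟨PowerSeries.mk g, ?_⟩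
    ext n
    simp [hg]

theorem choose_four_dvd (p : ℕ) (hp : p.Prime) (hp5 : 5 < p) (k i N : ℕ) (hk1 : 1 ≤ k)
    (hk4 : k ≤ 4) (h : k + i = N) (hN : p ∣ N) : p ∣ Nat.choose (4 + i) 4 := by
  have h1 : p ∣ (4 + i).descFactorial 4 := by
    simp only [Nat.descFactorial]
    obtain rfl | rfl | rfl | rfl : k = 1 ∨ k = 2 ∨ k = 3 ∨ k = 4 := by omega
    · have : 4 + i - 3 = N := by omega
      rw [this]; exact Dvd.dvd.mul_right hN _
    · have : 4 + i - 2 = N := by omega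
      rw [this]; exact Dvd.dvd.mul_left (Dvd.dvd.mul_right hN _) _
    · have : 4 + i - 1 = N := by omega
      rw [this]
      exact Dvd.dvd.mul_left (Dvd.dvd.mul_left (Dvd.dvd.mul_right hN _) _) _
    · have : 4 + i - 0 = N := by omega
      rw [this]
      exact Dvd.dvd.mul_left (Dvd.dvd.mul_left (Dvd.dvd.mul_left (Dvd.dvd.mul_right hN _) _) _) _
  rw [Nat.descFactorial_eq_factorial_mul_choose] at h1
  rcases (hp.dvd_mul).1 h1 with h2 | h2
  · have := (hp.dvd_factorial).1 h2
    omega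
  · exact h2

/-- Inductive step, in an abstract ring with a system of inverses `v`. -/
theorem step_abstract {R : Type*} [CommRing R] (p : ℕ) (hp : p.Prime) (hp5 : 5 < p) (v : ℕ → R)
    (hv0 : ∀ l, p ∣ l → v l = 0) (hv1 : ∀ l, ¬ p ∣ l → (l : R) * v l = 1) (r : ℕ) (hr : 1 ≤ r)
    (ih : ∀ m, ((p ^ r : ℕ) : R) ∣ PowerSeries.coeff (m * p ^ r) (PowerSeries.mk v ^ 4)) (m : ℕ) :
    ((p ^ (r + 1) : ℕ) : R) ∣ PowerSeries.coeff (m * p ^ (r + 1)) (PowerSeries.mk v ^ 4) := by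
  set q := p ^ r with hqdef
  have hqpos : 0 < q := pow_pos hp.pos r
  have hpq : p ∣ q := dvd_pow_self p (by omega)
  set f := PowerSeries.mk v with hf
  set F : Polynomial R := ∑ l ∈ range q, Polynomial.monomial l (v l) with hF
  set G : Polynomial R := ∑ l ∈ range q, Polynomial.monomial l (v l ^ 2) with hG
  have hFc : ∀ n, F.coeff n = if n < q then v n else 0 := by
    intro n; simp [hF, Polynomial.finsetSum_coeff, Polynomial.coeff_monomial]
  have hGc : ∀ n, G.coeff n = if n < q then v n ^ 2 else 0 := by
    intro n; simp [hG, Polynomial.finsetSum_coeff, Polynomial.coeff_monomial]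
  have hFd : F.natDegree ≤ q - 1 := by
    rw [Polynomial.natDegree_le_iff_coeff_eq_zero]
    intro n hn; rw [hFc, if_neg (by omega)]
  have hGd : G.natDegree ≤ q - 1 := by
    rw [Polynomial.natDegree_le_iff_coeff_eq_zero]
    intro n hn; rw [hGc, if_neg (by omega)]
  set Q : PowerSeries R := PowerSeries.C (q : R) with hQ
  -- local expansions
  have e1 : ∀ l, (q : R) ^ 2 ∣ v (l + q) - v l + q * v l ^ 2 := by
    intro l
    by_cases hl : p ∣ l
    · rw [hv0 l hl, hv0 _ (dvd_add hl hpq)]; simp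
    · have h1 := hv1 l hl
      have h2 := hv1 (l + q) (fun h => hl ((Nat.dvd_add_left hpq).1 h))
      push_cast at h2
      refine ⟨v l ^ 2 * v (l + q), ?_⟩
      generalize v (l + q) = b at *
      generalize v l = a at *
      generalize (l : R) = x at *
      generalize (q : R) = y at *
      have hb : (1 - y * a) * a - b + y ^ 2 * a ^ 2 * b = 0 := by
        linear_combination (-(1 - y * a) * a) * h2 + ((1 - y * a) * b) * h1
      linear_combination -hb
  have e2 : ∀ l, (q : R) ^ 2 ∣ v (l + 2 * q) - 2 * v (l + q) + v l := by
    intro l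
    have a1 := e1 l
    have a2 := e1 (l + q)
    have a3 : (q : R) ∣ v (l + q) - v l := by
      have := (dvd_trans (dvd_pow_self (q : R) two_ne_zero) a1)
      have h2 := dvd_sub this (dvd_mul_right (q : R) (v l ^ 2))
      simpa using h2
    obtain ⟨c1, h1⟩ := a1
    obtain ⟨c2, h2⟩ := a2
    obtain ⟨c3, h3⟩ := a3
    rw [show l + q + q = l + 2 * q by ring] at h2
    refine ⟨c2 - c1 - c3 * (v (l + q) + v l), ?_⟩
    linear_combination h2 - h1 - q * (v (l + q) + v l) * h3
  set Y : PowerSeries R := PowerSeries.X ^ q with hY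
  -- the approximation of f
  have key : Q ^ 2 ∣ (1 - Y) ^ 2 * f - ((F : PowerSeries R) * (1 - Y) - Q * (Y * G)) := by
    rw [hQ, ← map_pow, C_dvd_iff_coeff]
    intro n
    have hexp : (1 - Y) ^ 2 * f - ((F : PowerSeries R) * (1 - Y) - Q * (Y * (G : PowerSeries R)))
        = f - 2 * (PowerSeries.X ^ q * f) + PowerSeries.X ^ q * (PowerSeries.X ^ q * f)
          - (F : PowerSeries R)
          + PowerSeries.X ^ q * (F : PowerSeries R)
          + Q * (PowerSeries.X ^ q * (G : PowerSeries R)) := by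
      rw [hY]; ring
    have h2 : (2 : PowerSeries R) = PowerSeries.C (2 : R) := (map_ofNat _ 2).symm
    rw [hexp, h2, hQ]
    simp only [map_add, map_sub, PowerSeries.coeff_C_mul, PowerSeries.coeff_X_pow_mul',
      Polynomial.coeff_coe, hFc, hGc, hf, PowerSeries.coeff_mk]
    by_cases c1 : n < q
    · simp [c1, not_le.2 c1]
    · obtain ⟨l, rfl⟩ : ∃ l, n = l + q := ⟨n - q, by omega⟩
      simp only [Nat.add_sub_cancel, if_neg c1, if_pos (Nat.le_add_left q l)]
      by_cases c2 : l < q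
      · simp only [if_pos c2, if_neg (not_le.2 c2)]
        convert! e1 l using 1
        ring
      · obtain ⟨j, rfl⟩ : ∃ j, l = j + q := ⟨l - q, by omega⟩
        simp only [Nat.add_sub_cancel, if_neg c2, if_pos (Nat.le_add_left q j)]
        convert! e2 j using 1
        rw [show j + q + q = j + 2 * q by ring]
        ring
  set D : PowerSeries R := (F : PowerSeries R) ^ 4 * (1 - Y) - 4 * Q * Y * F ^ 3 * G with hD
  have hUnit : ∀ n, IsUnit ((1 - Y) ^ n) := by
    intro n
    apply IsUnit.pow
    rw [PowerSeries.isUnit_iff_constantCoeff]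
    simp [hY, hqpos.ne']
  have key2 : Q ^ 2 ∣ f ^ 4 * (1 - Y) ^ 5 - D := by
    have h3 : Q ^ 2 ∣ (1 - Y) ^ 3 * (f ^ 4 * (1 - Y) ^ 5 - D) := by
      obtain ⟨H, hH⟩ := key
      have hA := eq_add_of_sub_eq hH
      have h8 : (1 - Y) ^ 3 * (f ^ 4 * (1 - Y) ^ 5 - D)
        = ((1 - Y) ^ 2 * f) ^ 4 - (1 - Y) ^ 3 * D := by ring
      rw [h8, hA, hD]
      generalize (F : PowerSeries R) = F' at *
      generalize (G : PowerSeries R) = G' at *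
      generalize hB : F' * (1 - Y) - Q * (Y * G') = B
      have h9 : (Q ^ 2 * H + B) ^ 4 - (1 - Y) ^ 3 * (F' ^ 4 * (1 - Y) - 4 * Q * Y * F' ^ 3 * G')
        = Q ^ 2 * (H * ((Q ^ 2 * H + B) ^ 3 + (Q ^ 2 * H + B) ^ 2 * B + (Q ^ 2 * H + B) * B ^ 2
          + B ^ 3)) + (B ^ 4 - (1 - Y) ^ 3 * (F' ^ 4 * (1 - Y) - 4 * Q * Y * F' ^ 3 * G')) := by ring
      rw [h9]
      refine dvd_add (dvd_mul_right _ _) ?_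
      refine ⟨6 * (F' * (1 - Y)) ^ 2 * (Y * G') ^ 2 - 4 * (F' * (1 - Y)) * Q * (Y * G') ^ 3
        + Q ^ 2 * (Y * G') ^ 4, ?_⟩
      rw [← hB]; ring
    exact (IsUnit.dvd_mul_left (hUnit 3)).1 h3
  have hDdeg : ∀ n, 5 * q ≤ n → PowerSeries.coeff n D = 0 := by
    intro n hn
    have hDp : D = ((F ^ 4 * (1 - Polynomial.X ^ q)
        - Polynomial.C (4 * q : R) * Polynomial.X ^ q * F ^ 3 * G : Polynomial R) : PowerSeries R) := by
      have h4 : (4 : PowerSeries R) = PowerSeries.C (4 : R) := (map_ofNat _ 4).symm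
      rw [hD, hY, hQ, h4, ← map_mul]
      simp only [Polynomial.coe_sub, Polynomial.coe_mul, Polynomial.coe_pow, Polynomial.coe_C,
        Polynomial.coe_X, Polynomial.coe_one]
    rw [hDp, Polynomial.coeff_coe]
    apply Polynomial.coeff_eq_zero_of_natDegree_lt
    refine lt_of_lt_of_le ?_ hn
    have d1 : (F ^ 4 * (1 - Polynomial.X ^ q)
        - Polynomial.C (4 * q : R) * Polynomial.X ^ q * F ^ 3 * G : Polynomial R).natDegree
        ≤ 4 * (q - 1) + q := by
      have hX : (Polynomial.X ^ q : Polynomial R).natDegree ≤ q := Polynomial.natDegree_X_pow_le q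
      refine (Polynomial.natDegree_sub_le_of_le (m := 4 * (q - 1) + q) (n := 4 * (q - 1) + q)
        ?_ ?_).trans (max_self _).le
      · refine Polynomial.natDegree_mul_le_of_le (Polynomial.natDegree_pow_le_of_le 4 hFd) ?_
        refine (Polynomial.natDegree_sub_le_of_le (m := q) ?_ hX).trans (max_self _).le
        simp
      · have := Polynomial.natDegree_mul_le_of_le (Polynomial.natDegree_mul_le_of_le
          (Polynomial.natDegree_mul_le_of_le (Polynomial.natDegree_C (4 * q : R)).le hX)
          (Polynomial.natDegree_pow_le_of_le 3 hFd)) hGd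
        refine this.trans ?_
        omega
    omega
  set W := secT q (f ^ 4 * (1 - Y) ^ 5) with hW
  have hWeq : W = secT q (f ^ 4) * (1 - PowerSeries.X) ^ 5 := secT_mul_one_sub_pow q hqpos 5 _
  have hWq : ∀ k, (q : R) ∣ PowerSeries.coeff k W := by
    rw [← C_dvd_iff_coeff, hWeq]
    apply Dvd.dvd.mul_right
    rw [C_dvd_iff_coeff]
    intro n; rw [coeff_secT]; exact ih n
  have hW0 : PowerSeries.coeff 0 W = 0 := by
    have : PowerSeries.constantCoeff f = 0 := by
      rw [← PowerSeries.coeff_zero_eq_constantCoeff_apply, hf, PowerSeries.coeff_mk, hv0 0 (by simp)]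
    rw [hW, coeff_secT]; simp [this]
  have hW5 : ∀ k, 5 ≤ k → (q : R) ^ 2 ∣ PowerSeries.coeff k W := by
    intro k hk
    rw [hQ, ← map_pow, C_dvd_iff_coeff] at key2
    have := key2 (k * q)
    rwa [map_sub, hDdeg _ (Nat.mul_le_mul_right q hk), sub_zero, ← coeff_secT] at this
  have hinv : secT q (f ^ 4) = W * (PowerSeries.invOneSubPow R 5).val := by
    rw [hWeq, mul_assoc, ← PowerSeries.invOneSubPow_inv_eq_one_sub_pow, Units.inv_val, mul_one]
  have hgoal : m * p ^ (r + 1) = (m * p) * q := by rw [hqdef]; ring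
  rw [hgoal, ← coeff_secT, hinv, PowerSeries.coeff_mul]
  refine Finset.dvd_sum ?_
  rintro ⟨k, i⟩ hki
  rw [HasAntidiagonal.mem_antidiagonal] at hki
  have hpr : ((p ^ (r + 1) : ℕ) : R) = q * p := by rw [hqdef]; push_cast; ring
  rw [hpr, PowerSeries.invOneSubPow_val_eq_mk_sub_one_add_choose_of_pos R 5 (by norm_num),
    PowerSeries.coeff_mk]
  rcases Nat.eq_zero_or_pos k with rfl | hk
  · simp only [hW0, zero_mul, dvd_zero]
  · by_cases hk4 : k ≤ 4
    · apply mul_dvd_mul (hWq k)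
      have := choose_four_dvd p hp hp5 k i (m * p) hk hk4 hki (dvd_mul_left _ _)
      exact Nat.cast_dvd_cast this
    · apply Dvd.dvd.mul_right
      refine dvd_trans ?_ (hW5 k (by omega))
      rw [sq]
      exact mul_dvd_mul_left _ (Nat.cast_dvd_cast hpq)

theorem base_mod (p : ℕ) [hpf : Fact p.Prime] (hp5 : 5 < p)
    (h1 : PowerSeries.coeff p (PowerSeries.mk (fun l : ℕ => ((l : ZMod p))⁻¹) ^ 4) = 0) (m : ℕ) :
    PowerSeries.coeff (m * p) (PowerSeries.mk (fun l : ℕ => ((l : ZMod p))⁻¹) ^ 4) = 0 := by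
  have hp := hpf.out
  set f : PowerSeries (ZMod p) := PowerSeries.mk (fun l : ℕ => ((l : ZMod p))⁻¹) with hf
  set L : PowerSeries (ZMod p) :=
    ∑ a : ZMod p, PowerSeries.C a⁻¹ * PowerSeries.X ^ a.val with hL
  have hLc : ∀ n, PowerSeries.coeff n L = if n < p then ((n : ZMod p))⁻¹ else 0 := by
    intro n
    rw [hL, map_sum]
    simp only [PowerSeries.coeff_C_mul, PowerSeries.coeff_X_pow]
    split_ifs with hn
    · rw [Finset.sum_eq_single (n : ZMod p)]
      · rw [ZMod.val_natCast_of_lt hn, if_pos rfl, mul_one]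
      · intro b _ hb
        rw [if_neg, mul_zero]
        rintro rfl
        exact hb (by simp)
      · simp
    · refine Finset.sum_eq_zero ?_
      intro b _
      rw [if_neg, mul_zero]
      rintro rfl
      exact hn (ZMod.val_lt b)
  have hfL : f * (1 - PowerSeries.X ^ p) = L := by
    ext n
    rw [mul_sub, mul_one, map_sub, PowerSeries.coeff_mul_X_pow', hLc, hf]
    simp only [PowerSeries.coeff_mk]
    by_cases hn : n < p
    · simp [hn, not_le.2 hn]
    · obtain ⟨l, rfl⟩ : ∃ l, n = l + p := ⟨n - p, by omega⟩
      simp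
  have hL4 : L ^ 4 = f ^ 4 * (1 - PowerSeries.X ^ p) ^ 4 := by rw [← hfL, mul_pow]
  set V := secT p (L ^ 4) with hV
  have hVf : V = secT p (f ^ 4) * (1 - PowerSeries.X) ^ 4 := by
    rw [hV, hL4, secT_mul_one_sub_pow p hp.pos]
  have hVk : ∀ k, PowerSeries.coeff k V = ∑ l : Fin 4 → ZMod p,
      if k * p = ∑ i, (l i).val then ∏ i, (l i)⁻¹ else 0 := by
    intro k
    rw [hV, coeff_secT, hL, Fintype.sum_pow, map_sum]
    refine Finset.sum_congr rfl ?_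
    intro l _
    rw [Finset.prod_mul_distrib, ← map_prod, Finset.prod_pow_eq_pow_sum, PowerSeries.coeff_C_mul,
      PowerSeries.coeff_X_pow]
    simp
  have hbound : ∀ l : Fin 4 → ZMod p, (∏ i, (l i)⁻¹ ≠ 0) →
      0 < ∑ i, (l i).val ∧ ∑ i, (l i).val < 4 * p := by
    intro l hl
    rw [Finset.prod_ne_zero_iff] at hl
    have h0 := hl 0 (mem_univ _)
    have hpos : 0 < (l 0).val := by
      rw [ZMod.val_pos]; intro h; simp [h] at h0
    have a0 := ZMod.val_lt (l 0)
    have a1 := ZMod.val_lt (l 1)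
    have a2 := ZMod.val_lt (l 2)
    have a3 := ZMod.val_lt (l 3)
    rw [Fin.sum_univ_four]
    omega
  have hV0 : PowerSeries.coeff 0 V = 0 := by
    rw [hVk]
    refine Finset.sum_eq_zero ?_
    intro l _
    split_ifs with h
    · by_contra hne
      have := hbound l hne
      omega
    · rfl
  have hV4 : ∀ k, 4 ≤ k → PowerSeries.coeff k V = 0 := by
    intro k hk
    rw [hVk]
    refine Finset.sum_eq_zero ?_
    intro l _
    split_ifs with h
    · by_contra hne
      have := hbound l hne
      have : 4 * p ≤ k * p := Nat.mul_le_mul_right p hk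
      omega
    · rfl
  have hV1 : PowerSeries.coeff 1 V = 0 := by
    have hc : PowerSeries.constantCoeff f = 0 := by
      rw [← PowerSeries.coeff_zero_eq_constantCoeff_apply, hf, PowerSeries.coeff_mk]; simp
    have : ∃ g : PowerSeries (ZMod p), (1 - PowerSeries.X) ^ 4 = 1 + PowerSeries.X * g :=
      ⟨-4 + 6 * PowerSeries.X - 4 * PowerSeries.X ^ 2 + PowerSeries.X ^ 3, by ring⟩
    obtain ⟨g, hg⟩ := this
    rw [hVf, hg, mul_add, mul_one, map_add, coeff_secT, one_mul, h1, zero_add, mul_left_comm,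
      show (1 : ℕ) = 0 + 1 from rfl, PowerSeries.coeff_succ_X_mul,
      PowerSeries.coeff_zero_eq_constantCoeff_apply, map_mul,
      ← PowerSeries.coeff_zero_eq_constantCoeff_apply, coeff_secT]
    simp [hc]
  have hV3 : PowerSeries.coeff 3 V = 0 := by
    rw [← hV1, hVk, hVk]
    refine Fintype.sum_equiv (Equiv.neg _) _ _ ?_
    intro l
    by_cases hne : ∏ i, (l i)⁻¹ = 0
    · have : ∏ i, ((Equiv.neg (Fin 4 → ZMod p)) l i)⁻¹ = 0 := by
        rw [Finset.prod_eq_zero_iff] at hne ⊢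
        obtain ⟨i, hi, h⟩ := hne
        refine ⟨i, hi, ?_⟩
        simpa using h
      rw [hne, this]; simp
    · have hprod : ∏ i, ((Equiv.neg (Fin 4 → ZMod p)) l i)⁻¹ = ∏ i, (l i)⁻¹ := by
        simp [Fin.prod_univ_four]
        ring
      rw [hprod]
      have hv : ∀ i, ((Equiv.neg (Fin 4 → ZMod p)) l i).val = p - (l i).val := by
        intro i
        have hi := (Finset.prod_ne_zero_iff.1 hne) i (mem_univ _)
        have : l i ≠ 0 := by intro h; simp [h] at hi
        have : NeZero (l i) := ⟨this⟩
        simp [ZMod.val_neg_of_ne_zero]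
      have a0 := ZMod.val_lt (l 0)
      have a1 := ZMod.val_lt (l 1)
      have a2 := ZMod.val_lt (l 2)
      have a3 := ZMod.val_lt (l 3)
      have : (3 * p = ∑ i, (l i).val) ↔
          (1 * p = ∑ i, ((Equiv.neg (Fin 4 → ZMod p)) l i).val) := by
        simp only [hv, Fin.sum_univ_four]
        omega
      simp only [this]
  have hsum : PowerSeries.coeff 1 V + PowerSeries.coeff 2 V + PowerSeries.coeff 3 V = 0 := by
    have hA : PowerSeries.coeff 1 V + PowerSeries.coeff 2 V + PowerSeries.coeff 3 V
        = ∑ l : Fin 4 → ZMod p, if ∑ i, l i = 0 then ∏ i, (l i)⁻¹ else 0 := by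
      rw [hVk, hVk, hVk, ← Finset.sum_add_distrib, ← Finset.sum_add_distrib]
      refine Finset.sum_congr rfl ?_
      intro l _
      by_cases hne : ∏ i, (l i)⁻¹ = 0
      · simp [hne]
      · obtain ⟨b1, b2⟩ := hbound l hne
        have hz : ∑ i, l i = ((∑ i, (l i).val : ℕ) : ZMod p) := by simp
        have hz2 : (∑ i, l i = 0) ↔ p ∣ ∑ i, (l i).val := by rw [hz, ZMod.natCast_eq_zero_iff]
        simp only [hz2]
        clear hz hz2
        generalize ∑ i, (l i).val = S at *
        generalize ∏ i, (l i)⁻¹ = P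
        by_cases hd : p ∣ S
        · rw [if_pos hd]
          obtain ⟨c, rfl⟩ := hd
          have c1 : 0 < c := Nat.pos_of_mul_pos_left b1
          have c2 : c < 4 := by
            rw [mul_comm] at b2
            exact lt_of_mul_lt_mul_right b2 (Nat.zero_le p)
          have hpp := hp.pos
          obtain rfl | rfl | rfl : c = 1 ∨ c = 2 ∨ c = 3 := by omega
          · rw [if_pos (by omega), if_neg (by omega), if_neg (by omega)]; ring
          · rw [if_neg (by omega), if_pos (by omega), if_neg (by omega)]; ring
          · rw [if_neg (by omega), if_neg (by omega), if_pos (by omega)]; ring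
        · rw [if_neg hd, if_neg, if_neg, if_neg]
          · ring
          all_goals
            rintro rfl
            exact hd (dvd_mul_left _ _)
    rw [hA]
    have h2 : (2 : ZMod p) ≠ 0 := by
      have : ((2 : ℕ) : ZMod p) ≠ 0 := by
        rw [Ne, ZMod.natCast_eq_zero_iff]
        exact fun h => by have := Nat.le_of_dvd (by norm_num) h; omega
      exact_mod_cast this
    have h15 : (15 : ZMod p) ≠ 0 := by
      have : ((15 : ℕ) : ZMod p) ≠ 0 := by
        rw [Ne, ZMod.natCast_eq_zero_iff]
        intro h
        have h35 : p ∣ 3 * 5 := h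
        rcases (hp.dvd_mul).1 h35 with h | h <;>
          · have := Nat.le_of_dvd (by norm_num) h
            omega
      exact_mod_cast this
    set A := ∑ l : Fin 4 → ZMod p, if ∑ i, l i = 0 then ∏ i, (l i)⁻¹ else 0 with hAdef
    have hscale : A = 16 * A := by
      conv_rhs => rw [hAdef]
      rw [Finset.mul_sum, hAdef]
      refine Fintype.sum_equiv (Equiv.piCongrRight fun _ : Fin 4 =>
        (Equiv.mulLeft₀ (2 : ZMod p) h2)) _ _ ?_
      intro l
      have hmul : ∀ a, Equiv.mulLeft₀ (2 : ZMod p) h2 a = 2 * a := fun _ => rfl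
      simp only [Equiv.piCongrRight_apply, Pi.map_apply, hmul, ← Finset.mul_sum,
        mul_eq_zero, h2, false_or]
      split_ifs
      · simp only [Fin.prod_univ_four, mul_inv]
        have : (2 : ZMod p) * 2⁻¹ = 1 := mul_inv_cancel₀ h2
        generalize (2 : ZMod p)⁻¹ = t at *
        have h16 : 16 * t ^ 4 = 1 := by
          have : (2 * t) ^ 4 = 1 := by rw [this, one_pow]
          linear_combination this
        linear_combination (-(l 0)⁻¹ * (l 1)⁻¹ * (l 2)⁻¹ * (l 3)⁻¹) * h16
      · simp
    have : 15 * A = 0 := by linear_combination -hscale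
    exact (mul_eq_zero.1 this).resolve_left h15
  have hVz : V = 0 := by
    ext k
    rw [map_zero]
    by_cases hk : 4 ≤ k
    · exact hV4 k hk
    · obtain rfl | rfl | rfl | rfl : k = 0 ∨ k = 1 ∨ k = 2 ∨ k = 3 := by omega
      · exact hV0
      · exact hV1
      · rw [hV1, hV3] at hsum; simpa using hsum
      · exact hV3
  have hz : secT p (f ^ 4) = 0 := by
    have : secT p (f ^ 4) = V * (PowerSeries.invOneSubPow (ZMod p) 4).val := by
      rw [hVf, mul_assoc, ← PowerSeries.invOneSubPow_inv_eq_one_sub_pow, Units.inv_val, mul_one]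
    rw [this, hVz, zero_mul]
  rw [← coeff_secT, hz, map_zero]

theorem log_pow_coeff {K : Type*} [Field K] [CharZero K] (N : ℕ) : ∀ n : ℕ,
    (N.factorial : K) * PowerSeries.coeff N (PowerSeries.mk (fun l : ℕ => ((l : K))⁻¹) ^ n)
      = n.factorial * (((ascPochhammer ℤ N).coeff n : ℤ) : K) := by
  set Λ : PowerSeries K := PowerSeries.mk (fun l : ℕ => ((l : K))⁻¹) with hΛ
  have hΛ0 : PowerSeries.constantCoeff Λ = 0 := by
    rw [← PowerSeries.coeff_zero_eq_constantCoeff_apply, hΛ, PowerSeries.coeff_mk]; simp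
  have hder : (1 - PowerSeries.X) * PowerSeries.derivative K Λ = 1 := by
    have : PowerSeries.derivative K Λ = PowerSeries.mk 1 := by
      ext n
      rw [PowerSeries.coeff_derivative, hΛ, PowerSeries.coeff_mk, PowerSeries.coeff_mk]
      have : ((n : K) + 1) ≠ 0 := by exact_mod_cast Nat.succ_ne_zero n
      push_cast
      simp [this]
    rw [this, mul_comm, PowerSeries.mk_one_mul_one_sub_eq_one]
  have hrec : ∀ n N : ℕ, ((N : K) + 1) * PowerSeries.coeff (N + 1) (Λ ^ (n + 1))
      = N * PowerSeries.coeff N (Λ ^ (n + 1)) + (n + 1) * PowerSeries.coeff N (Λ ^ n) := by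
    intro n N
    have h1 : (1 - PowerSeries.X) * PowerSeries.derivative K (Λ ^ (n + 1))
        = PowerSeries.C ((n : K) + 1) * Λ ^ n := by
      rw [PowerSeries.derivative_pow]
      have : PowerSeries.C ((n : K) + 1) = ((n + 1 : ℕ) : PowerSeries K) := by simp
      rw [this, Nat.add_sub_cancel]
      linear_combination ((n + 1 : ℕ) : PowerSeries K) * Λ ^ n * hder
    have h2 := congrArg (PowerSeries.coeff N) h1
    rw [sub_mul, one_mul, map_sub, PowerSeries.coeff_C_mul, PowerSeries.coeff_derivative] at h2
    cases N with
    | zero =>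
      simp only [PowerSeries.coeff_zero_X_mul] at h2
      push_cast at h2 ⊢
      linear_combination h2
    | succ M =>
      rw [PowerSeries.coeff_succ_X_mul, PowerSeries.coeff_derivative] at h2
      push_cast at h2 ⊢
      linear_combination h2
  induction N with
  | zero =>
    intro n
    cases n with
    | zero => simp
    | succ n => simp [hΛ0, Polynomial.coeff_one]
  | succ N ih =>
    intro n
    rw [ascPochhammer_succ_right]
    cases n with
    | zero =>
      have h0 : (ascPochhammer ℤ N * (Polynomial.X + (N : Polynomial ℤ))).coeff 0 = 0 := by
        rw [Polynomial.mul_coeff_zero]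
        by_cases hN : N = 0
        · simp [hN]
        · rw [Polynomial.coeff_zero_eq_eval_zero, ascPochhammer_eval_zero, if_neg hN, zero_mul]
      rw [h0, pow_zero, PowerSeries.coeff_one, if_neg (Nat.succ_ne_zero N)]
      simp
    | succ n =>
      have hc : (ascPochhammer ℤ N * (Polynomial.X + (N : Polynomial ℤ))).coeff (n + 1)
          = (ascPochhammer ℤ N).coeff n + (ascPochhammer ℤ N).coeff (n + 1) * N := by
        rw [mul_add, Polynomial.coeff_add, Polynomial.coeff_mul_X,
          ← Polynomial.C_eq_natCast, Polynomial.coeff_mul_C]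
      rw [hc, Nat.factorial_succ N]
      push_cast
      have i1 := ih n
      have i2 := ih (n + 1)
      have i3 := hrec n N
      rw [Nat.factorial_succ n] at i2 ⊢
      push_cast at i2 ⊢
      linear_combination (N.factorial : K) * i3 + (N : K) * i2 + ((n : K) + 1) * i1

theorem poch_coeff_dvd (p : ℕ) (hp : p.Prime) (hp5 : 5 < p) :
    ((p : ℤ) ^ 2) ∣ (ascPochhammer ℤ p).coeff 4 := by
  have hpf : Fact p.Prime := ⟨hp⟩
  obtain ⟨n, rfl⟩ : ∃ n, p = n + 1 := ⟨p - 1, by omega⟩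
  set P : Polynomial ℤ := (ascPochhammer ℤ n).comp (Polynomial.X + 1) with hP
  have hQ : ascPochhammer ℤ (n + 1) = Polynomial.X * P := ascPochhammer_succ_left ℤ n
  have hprod : P = ∏ i ∈ range n, (Polynomial.X + Polynomial.C ((i : ℤ) + 1)) := by
    rw [hP]
    clear hP hQ hpf hp hp5 P
    induction n with
    | zero => simp
    | succ n ih =>
      rw [ascPochhammer_succ_right, Polynomial.mul_comp, ih, Finset.prod_range_succ]
      congr 1
      simp
      ring
  have heven : Even n := by
    have := hp.odd_of_ne_two (by omega)
    rw [Nat.odd_add_one] at this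
    exact Nat.not_odd_iff_even.1 this
  have hrefl : Polynomial.taylor (-((n + 1 : ℕ) : ℤ)) P
      = P.comp (Polynomial.C (-1) * Polynomial.X) := by
    rw [Polynomial.taylor_apply, hprod, Polynomial.prod_comp, Polynomial.prod_comp,
      ← Finset.prod_range_reflect]
    have h1 : (∏ i ∈ range n, (-1 : Polynomial ℤ)) = 1 := by
      rw [Finset.prod_const, Finset.card_range, heven.neg_one_pow]
    rw [← one_mul (∏ j ∈ range n, _), ← h1, ← Finset.prod_mul_distrib]
    refine Finset.prod_congr rfl ?_
    intro i hi
    rw [Finset.mem_range] at hi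
    obtain ⟨j, rfl⟩ : ∃ j, n = i + j + 1 := ⟨n - i - 1, by omega⟩
    rw [show i + j + 1 - 1 - i = j by omega]
    simp
    ring
  have hc3 := congrArg (fun R : Polynomial ℤ => R.coeff 3) hrefl
  simp only [Polynomial.comp_C_mul_X_coeff, Polynomial.taylor_coeff] at hc3
  set D := Polynomial.hasseDeriv 3 P with hD
  have hD0 : D.coeff 0 = P.coeff 3 := by rw [hD, Polynomial.hasseDeriv_coeff]; simp
  have hD1 : D.coeff 1 = 4 * P.coeff 4 := by
    rw [hD, Polynomial.hasseDeriv_coeff]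
    norm_num [Nat.choose]
  have hDe : ∀ x : ℤ, ∃ c, D.eval x = D.coeff 0 + D.coeff 1 * x + x ^ 2 * c := by
    intro x
    refine ⟨D.divX.divX.eval x, ?_⟩
    conv_lhs => rw [← Polynomial.divX_mul_X_add D, ← Polynomial.divX_mul_X_add D.divX]
    simp [Polynomial.coeff_divX]
    ring
  have hc4 : ((n + 1 : ℕ) : ℤ) ∣ P.coeff 4 := by
    have hQ4 : P.coeff 4 = (ascPochhammer ℤ (n + 1)).coeff 5 := by
      rw [hQ, Polynomial.coeff_X_mul]
    rw [hQ4, ← ZMod.intCast_zmod_eq_zero_iff_dvd]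
    have hmap : ascPochhammer (ZMod (n + 1)) (n + 1) = Polynomial.X ^ (n + 1) - Polynomial.X := by
      have hdeg : (ascPochhammer (ZMod (n + 1)) (n + 1)).natDegree = n + 1 :=
        ascPochhammer_natDegree _ _
      have hmon : (ascPochhammer (ZMod (n + 1)) (n + 1)).Monic := monic_ascPochhammer _ _
      have hdeg2 : (Polynomial.X ^ (n + 1) - Polynomial.X : Polynomial (ZMod (n + 1))).natDegree
          = n + 1 := FiniteField.X_pow_card_sub_X_natDegree_eq _ hp.one_lt
      have hmon2 : (Polynomial.X ^ (n + 1) - Polynomial.X : Polynomial (ZMod (n + 1))).Monic := by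
        apply Polynomial.monic_X_pow_sub
        rw [Polynomial.degree_X]
        exact_mod_cast (by omega : 1 < n + 1)
      refine Polynomial.eq_of_degree_sub_lt_of_eval_finset_eq univ ?_ ?_
      · rw [Finset.card_univ, ZMod.card]
        have h := Polynomial.degree_sub_lt_left (p := ascPochhammer (ZMod (n + 1)) (n + 1))
          (q := Polynomial.X ^ (n + 1) - Polynomial.X) ?_ hmon.ne_zero ?_
        · rwa [Polynomial.degree_eq_natDegree hmon.ne_zero, hdeg] at h
        · rw [Polynomial.degree_eq_natDegree hmon.ne_zero,
            Polynomial.degree_eq_natDegree hmon2.ne_zero, hdeg, hdeg2]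
        · rw [hmon.leadingCoeff, hmon2.leadingCoeff]
      · intro a _
        have e2 : (Polynomial.X ^ (n + 1) - Polynomial.X : Polynomial (ZMod (n + 1))).eval a = 0 := by
          simp [ZMod.pow_card]
        have hpe : ∀ N : ℕ, (ascPochhammer (ZMod (n + 1)) N).eval a = ∏ i ∈ range N, (a + i) := by
          intro N
          induction N with
          | zero => simp
          | succ N ihN => rw [ascPochhammer_succ_eval, ihN, Finset.prod_range_succ]
        rw [e2, hpe]
        refine Finset.prod_eq_zero (i := (-a).val) ?_ ?_
        · rw [Finset.mem_range]; exact ZMod.val_lt _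
        · simp
    have := congrArg (fun R : Polynomial (ZMod (n + 1)) => R.coeff 5) hmap
    rw [← ascPochhammer_map (Int.castRingHom (ZMod (n + 1)))] at this
    simp only [Polynomial.coeff_map, Polynomial.coeff_sub, Polynomial.coeff_X_pow,
      Polynomial.coeff_X] at this
    rw [if_neg (by omega), if_neg (by omega)] at this
    simpa using this
  rw [hQ, Polynomial.coeff_X_mul]
  obtain ⟨c, hc⟩ := hDe (-((n + 1 : ℕ) : ℤ))
  obtain ⟨d, hd⟩ := hc4
  rw [hc, hD0, hD1, hd] at hc3
  have h2 : (((n + 1 : ℕ) : ℤ) ^ 2) ∣ 2 * P.coeff 3 := ⟨4 * d - c, by linear_combination hc3⟩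
  refine IsCoprime.dvd_of_dvd_mul_left ?_ h2
  apply IsCoprime.pow_left
  refine (Nat.isCoprime_iff_coprime (m := n + 1) (n := 2)).2 ?_
  exact (Nat.coprime_primes hp Nat.prime_two).2 (by omega)

/-- The inverse of `l` in the `p`-adic integers (`0` when `p ∣ l`). -/
noncomputable def vinv (p : ℕ) [Fact p.Prime] (l : ℕ) : ℤ_[p] := Ring.inverse (l : ℤ_[p])

theorem isUnit_natCast_iff' (p : ℕ) [Fact p.Prime] (l : ℕ) : IsUnit (l : ℤ_[p]) ↔ ¬ p ∣ l := by
  rw [PadicInt.isUnit_iff, PadicInt.norm_natCast_eq_one_iff]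
  exact (Nat.Prime.coprime_iff_not_dvd (Fact.out))

theorem vinv_of_dvd (p : ℕ) [Fact p.Prime] (l : ℕ) (h : p ∣ l) : vinv p l = 0 :=
  Ring.inverse_non_unit _ (by rw [isUnit_natCast_iff']; exact not_not.2 h)

theorem vinv_of_not_dvd (p : ℕ) [Fact p.Prime] (l : ℕ) (h : ¬ p ∣ l) :
    (l : ℤ_[p]) * vinv p l = 1 :=
  Ring.mul_inverse_cancel _ ((isUnit_natCast_iff' p l).2 h)

theorem vinv_coe (p : ℕ) [Fact p.Prime] (l : ℕ) :
    ((vinv p l : ℤ_[p]) : ℚ_[p]) = if p ∣ l then 0 else ((l : ℚ_[p]))⁻¹ := by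
  split_ifs with h
  · rw [vinv_of_dvd p l h]; simp
  · have h1 := congrArg (fun x : ℤ_[p] => (x : ℚ_[p])) (vinv_of_not_dvd p l h)
    simp only [PadicInt.coe_mul, PadicInt.coe_natCast, PadicInt.coe_one] at h1
    exact (inv_eq_of_mul_eq_one_right h1).symm

theorem base_one (p : ℕ) [hpf : Fact p.Prime] (hp5 : 5 < p) :
    (p : ℤ_[p]) ∣ PowerSeries.coeff p (PowerSeries.mk (vinv p) ^ 4) := by
  have hp := hpf.out
  set Z := PowerSeries.coeff p (PowerSeries.mk (vinv p) ^ 4) with hZ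
  set f : PowerSeries ℚ_[p] := PowerSeries.map PadicInt.Coe.ringHom (PowerSeries.mk (vinv p)) with hf
  set Λ : PowerSeries ℚ_[p] := PowerSeries.mk (fun l : ℕ => ((l : ℚ_[p]))⁻¹) with hΛ
  have hfc : ∀ l, PowerSeries.coeff l f = if p ∣ l then 0 else ((l : ℚ_[p]))⁻¹ := by
    intro l
    rw [hf, PowerSeries.coeff_map, PowerSeries.coeff_mk]
    exact vinv_coe p l
  have hZc : (Z : ℚ_[p]) = PowerSeries.coeff p (f ^ 4) := by
    rw [hf, ← map_pow, PowerSeries.coeff_map, hZ]; rfl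
  have hZΛ : (Z : ℚ_[p]) = PowerSeries.coeff p (Λ ^ 4) := by
    rw [hZc, ← sub_eq_zero, ← map_sub]
    have h1 : PowerSeries.X ^ p ∣ f - Λ := by
      rw [PowerSeries.X_pow_dvd_iff]
      intro m hm
      rw [map_sub, hfc, hΛ, PowerSeries.coeff_mk]
      split_ifs with h
      · have : m = 0 := Nat.eq_zero_of_dvd_of_lt h hm
        simp [this]
      · simp
    have h2 : PowerSeries.X ∣ f := by
      rw [PowerSeries.X_dvd_iff, ← PowerSeries.coeff_zero_eq_constantCoeff_apply, hfc]; simp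
    have h3 : PowerSeries.X ∣ Λ := by
      rw [PowerSeries.X_dvd_iff, ← PowerSeries.coeff_zero_eq_constantCoeff_apply, hΛ]; simp
    have h4 : PowerSeries.X ^ (p + 1) ∣ f ^ 4 - Λ ^ 4 := by
      have : f ^ 4 - Λ ^ 4 = (f - Λ) * (f * (f ^ 2 + f * Λ + Λ ^ 2) + Λ * Λ ^ 2) := by ring
      rw [this, pow_succ]
      exact mul_dvd_mul h1 (dvd_add (Dvd.dvd.mul_right h2 _) (Dvd.dvd.mul_right h3 _))
    exact (PowerSeries.X_pow_dvd_iff.1 h4) p (by omega)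
  have hlog := log_pow_coeff (K := ℚ_[p]) p 4
  rw [← hΛ, ← hZΛ] at hlog
  obtain ⟨c, hc⟩ := poch_coeff_dvd p hp hp5
  rw [hc] at hlog
  have hZint : ((p.factorial : ℕ) : ℤ_[p]) * Z = ((4 : ℕ).factorial : ℤ_[p]) * (((p : ℤ) ^ 2 * c : ℤ) : ℤ_[p]) := by
    apply Subtype.ext
    push_cast at hlog ⊢
    exact hlog
  have hfact : ((p.factorial : ℕ) : ℤ_[p]) = p * ((p - 1).factorial : ℕ) := by
    rw [← Nat.mul_factorial_pred hp.ne_zero]; push_cast; rfl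
  have hp0 : (p : ℤ_[p]) ≠ 0 := by exact_mod_cast hp.ne_zero
  have h5 : (p : ℤ_[p]) ∣ ((p - 1).factorial : ℕ) * Z := by
    refine ⟨((4 : ℕ).factorial : ℤ_[p]) * (c : ℤ_[p]), ?_⟩
    apply mul_left_cancel₀ hp0
    rw [← mul_assoc, ← hfact, hZint]
    push_cast
    ring
  have hu : IsUnit (((p - 1).factorial : ℕ) : ℤ_[p]) := by
    rw [isUnit_natCast_iff']
    intro h
    have := (hp.dvd_factorial).1 h
    have := hp.pos
    omega
  exact (IsUnit.dvd_mul_left hu).1 h5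

theorem all_dvd (p : ℕ) [hpf : Fact p.Prime] (hp5 : 5 < p) (r : ℕ) (hr : 1 ≤ r) : ∀ m : ℕ,
    ((p ^ r : ℕ) : ℤ_[p]) ∣ PowerSeries.coeff (m * p ^ r) (PowerSeries.mk (vinv p) ^ 4) := by
  have hp := hpf.out
  have hker : ∀ x : ℤ_[p], PadicInt.toZMod x = 0 ↔ (p : ℤ_[p]) ∣ x := by
    intro x
    rw [← RingHom.mem_ker, PadicInt.ker_toZMod, PadicInt.maximalIdeal_eq_span_p,
      Ideal.mem_span_singleton]
  induction r, hr using Nat.le_induction with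
  | base =>
    intro m
    rw [pow_one]
    have hmap : PowerSeries.map (PadicInt.toZMod (p := p)) (PowerSeries.mk (vinv p))
        = PowerSeries.mk (fun l : ℕ => ((l : ZMod p))⁻¹) := by
      ext l
      rw [PowerSeries.coeff_map, PowerSeries.coeff_mk, PowerSeries.coeff_mk]
      by_cases h : p ∣ l
      · rw [vinv_of_dvd p l h, map_zero, (ZMod.natCast_eq_zero_iff l p).2 h, inv_zero]
      · have h1 := congrArg (PadicInt.toZMod (p := p)) (vinv_of_not_dvd p l h)
        rw [map_mul, map_natCast, map_one] at h1
        exact (inv_eq_of_mul_eq_one_right h1).symm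
    have hco : ∀ n, PadicInt.toZMod (PowerSeries.coeff n (PowerSeries.mk (vinv p) ^ 4))
        = PowerSeries.coeff n (PowerSeries.mk (fun l : ℕ => ((l : ZMod p))⁻¹) ^ 4) := by
      intro n
      rw [← hmap, ← map_pow, PowerSeries.coeff_map]
    rw [← hker, hco]
    apply base_mod p hp5
    rw [← hco, hker]
    exact base_one p hp5
  | succ r hr ih =>
    intro m
    exact step_abstract p hp hp5 (vinv p) (vinv_of_dvd p) (vinv_of_not_dvd p) r hr ih m

/-- `1/l` for `l` prime to `p`, and `0` otherwise. -/
noncomputable def winv (p : ℕ) (l : ℕ) : ℚ := if p ∣ l then 0 else (l : ℚ)⁻¹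

theorem coeff_prod_tuple {R : Type*} [CommRing R] {n : ℕ} (N : ℕ) (h : Fin n → PowerSeries R) :
    PowerSeries.coeff N (∏ i, h i)
      = ∑ l ∈ Finset.Nat.antidiagonalTuple n N, ∏ i, PowerSeries.coeff (l i) (h i) := by
  rw [PowerSeries.coeff_prod]
  refine Finset.sum_bij (fun l _ => (l : Fin n → ℕ)) ?_ ?_ ?_ ?_
  · intro l hl
    rw [Finset.mem_finsuppAntidiag] at hl
    rw [Finset.Nat.mem_antidiagonalTuple]
    exact hl.1
  · intro a _ b _ hab
    exact DFunLike.coe_injective hab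
  · intro b hb
    rw [Finset.Nat.mem_antidiagonalTuple] at hb
    refine ⟨Finsupp.equivFunOnFinite.symm b, ?_, rfl⟩
    rw [Finset.mem_finsuppAntidiag]
    exact ⟨hb, Finset.subset_univ _⟩
  · intro a _; rfl

theorem sigma_eq (p n b N : ℕ) : sigmaSum p n b N = PowerSeries.coeff N (∏ i : Fin n,
    if (i : ℕ) < b then PowerSeries.rescale (-1 : ℚ) (PowerSeries.mk (winv p))
      else PowerSeries.mk (winv p)) := by
  rw [coeff_prod_tuple, sigmaSum, Finset.sum_filter]
  refine Finset.sum_congr rfl ?_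
  intro l _
  have h1 : ∀ i : Fin n, PowerSeries.coeff (l i) (if (i : ℕ) < b then
      PowerSeries.rescale (-1 : ℚ) (PowerSeries.mk (winv p)) else PowerSeries.mk (winv p))
      = (if (i : ℕ) < b then (-1 : ℚ) ^ (l i) else 1) * winv p (l i) := by
    intro i
    split_ifs
    · rw [PowerSeries.coeff_rescale, PowerSeries.coeff_mk]
    · rw [PowerSeries.coeff_mk, one_mul]
  rw [Finset.prod_congr rfl (fun i _ => h1 i), Finset.prod_mul_distrib, ← Finset.prod_filter,
    Finset.prod_pow_eq_pow_sum]
  split_ifs with h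
  · congr 1
    refine Finset.prod_congr rfl ?_
    intro i _
    rw [winv, if_neg (h i).2]
  · push Not at h
    obtain ⟨i, hi⟩ := h
    have : winv p (l i) = 0 := by
      rcases Nat.eq_zero_or_pos (l i) with h0 | h0
      · simp [winv, h0]
      · simp [winv, hi h0]
    rw [Finset.prod_eq_zero (mem_univ i) this, mul_zero]

theorem sigma_identity (p : ℕ) (hp : p.Prime) (hp5 : 5 < p) (N : ℕ) :
    2 * (4 * sigmaSum p 4 1 (2 * N) + 3 * sigmaSum p 4 2 (2 * N))
      = PowerSeries.coeff N (PowerSeries.mk (winv p) ^ 4)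
        - 2 * PowerSeries.coeff (2 * N) (PowerSeries.mk (winv p) ^ 4) := by
  set f := PowerSeries.mk (winv p) with hf
  set g := PowerSeries.rescale (-1 : ℚ) f with hg
  have hs1 : sigmaSum p 4 1 (2 * N) = PowerSeries.coeff (2 * N) (g * f ^ 3) := by
    rw [sigma_eq, Fin.prod_univ_four]
    simp [← hf, ← hg]
    congr 1
    ring
  have hs2 : sigmaSum p 4 2 (2 * N) = PowerSeries.coeff (2 * N) (g ^ 2 * f ^ 2) := by
    rw [sigma_eq, Fin.prod_univ_four]
    simp [← hf, ← hg]
    congr 1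
    ring
  have hgf : PowerSeries.rescale (-1 : ℚ) g = f := by
    rw [hg, PowerSeries.rescale_rescale]; simp
  have hres : ∀ a : PowerSeries ℚ, PowerSeries.coeff (2 * N) (PowerSeries.rescale (-1 : ℚ) a)
      = PowerSeries.coeff (2 * N) a := by
    intro a
    rw [PowerSeries.coeff_rescale, pow_mul]; simp
  have hs3 : PowerSeries.coeff (2 * N) (f * g ^ 3) = PowerSeries.coeff (2 * N) (g * f ^ 3) := by
    rw [← hres (f * g ^ 3), map_mul, map_pow, hgf, ← hg]
  have hs4 : PowerSeries.coeff (2 * N) (g ^ 4) = PowerSeries.coeff (2 * N) (f ^ 4) := by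
    rw [← hres (g ^ 4), map_pow, hgf]
  have hexp : f + g = PowerSeries.expand 2 two_ne_zero f := by
    ext n
    rw [map_add, hg, PowerSeries.coeff_rescale, hf, PowerSeries.coeff_mk]
    rcases Nat.even_or_odd n with he | ho
    · obtain ⟨k, rfl⟩ := he
      rw [show k + k = 2 * k by ring, PowerSeries.coeff_expand_mul, PowerSeries.coeff_mk, winv, winv]
      have : p ∣ 2 * k ↔ p ∣ k := by
        rw [hp.dvd_mul]
        constructor
        · rintro (h | h)
          · have := Nat.le_of_dvd (by norm_num) h; omega
          · exact h
        · exact Or.inr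
      simp only [this]
      split_ifs
      · simp
      · rw [pow_mul]; push_cast; rw [mul_inv]; norm_num; ring
    · rw [PowerSeries.coeff_expand_of_not_dvd _ _ _ (by rw [← even_iff_two_dvd]; exact Nat.not_even_iff_odd.2 ho),
        ho.neg_one_pow]
      ring
  have h4 : PowerSeries.coeff (2 * N) ((f + g) ^ 4) = PowerSeries.coeff N (f ^ 4) := by
    rw [hexp, ← map_pow, PowerSeries.coeff_expand_mul]
  have h5 : (f + g) ^ 4 = f ^ 4 + PowerSeries.C (4 : ℚ) * (g * f ^ 3)
      + PowerSeries.C (6 : ℚ) * (g ^ 2 * f ^ 2) + PowerSeries.C (4 : ℚ) * (f * g ^ 3) + g ^ 4 := by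
    have c4 : PowerSeries.C (4 : ℚ) = 4 := map_ofNat _ 4
    have c6 : PowerSeries.C (6 : ℚ) = 6 := map_ofNat _ 6
    rw [c4, c6]; ring
  rw [h5] at h4
  simp only [map_add, PowerSeries.coeff_C_mul, hs3, hs4, ← hs1, ← hs2] at h4
  rw [← h4]
  ring

theorem winv_coeff_cast (p : ℕ) [Fact p.Prime] (n : ℕ) :
    ((PowerSeries.coeff n (PowerSeries.mk (winv p) ^ 4) : ℚ) : ℚ_[p])
      = ((PowerSeries.coeff n (PowerSeries.mk (vinv p) ^ 4) : ℤ_[p]) : ℚ_[p]) := by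
  have h : PowerSeries.map (Rat.castHom ℚ_[p]) (PowerSeries.mk (winv p))
      = PowerSeries.map PadicInt.Coe.ringHom (PowerSeries.mk (vinv p)) := by
    ext l
    rw [PowerSeries.coeff_map, PowerSeries.coeff_map, PowerSeries.coeff_mk, PowerSeries.coeff_mk]
    have h2 : PadicInt.Coe.ringHom (vinv p l) = ((vinv p l : ℤ_[p]) : ℚ_[p]) := rfl
    rw [h2, vinv_coe, winv]
    split_ifs <;> simp
  have h2 := congrArg (fun a => PowerSeries.coeff n (a ^ 4)) h
  simp only [← map_pow, PowerSeries.coeff_map] at h2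
  exact h2

theorem stmt14 (r : ℕ) (hr : 1 ≤ r) (p : ℕ) (hp : p.Prime) (hp5 : 5 < p) :
    padicCong p r
      (4 * sigmaSum p 4 1 (2 * p ^ r) + 3 * sigmaSum p 4 2 (2 * p ^ r)) 0 := by
  have hpf : Fact p.Prime := ⟨hp⟩
  have hid := sigma_identity p hp hp5 (p ^ r)
  set x := 4 * sigmaSum p 4 1 (2 * p ^ r) + 3 * sigmaSum p 4 2 (2 * p ^ r) with hx
  by_cases hx0 : x = 0
  · exact Or.inl hx0
  right
  rw [sub_zero]
  have d1 := all_dvd p hp5 r hr 1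
  have d2 := all_dvd p hp5 r hr 2
  rw [one_mul] at d1
  obtain ⟨a, ha⟩ := d1
  obtain ⟨b, hb⟩ := d2
  have hc := congrArg (fun t : ℚ => (t : ℚ_[p])) hid
  simp only [Rat.cast_mul, Rat.cast_sub, winv_coeff_cast, ha, hb] at hc
  have h2 : ‖((2 : ℚ) : ℚ_[p])‖ = 1 := by
    have : ((2 : ℚ) : ℚ_[p]) = ((2 : ℕ) : ℚ_[p]) := by push_cast; rfl
    rw [this, Padic.norm_natCast_eq_one_iff]
    exact (Nat.coprime_primes hp Nat.prime_two).2 (by omega)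
  have hc2 : ((2 : ℚ) : ℚ_[p]) * (x : ℚ_[p]) = (((p : ℤ_[p]) ^ r * (a - b - b) : ℤ_[p]) : ℚ_[p]) := by
    rw [hc]; push_cast; ring
  have hnorm : ‖(x : ℚ_[p])‖ ≤ (p : ℝ) ^ (-(r : ℤ)) := by
    have h3 := congrArg norm hc2
    rw [norm_mul, h2, one_mul] at h3
    rw [h3, ← PadicInt.norm_def, PadicInt.norm_le_pow_iff_mem_span_pow, Ideal.mem_span_singleton]
    exact dvd_mul_right _ _
  have hxc : (x : ℚ_[p]) ≠ 0 := by exact_mod_cast hx0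
  rw [Padic.norm_eq_zpow_neg_valuation hxc, Padic.valuation_ratCast,
    zpow_le_zpow_iff_right₀ (by exact_mod_cast hp.one_lt)] at hnorm
  omega
end

section
/- Let r ≥ 2 be an integer and let p be a prime with p > 7. Then 6·σ_6^{(1)}(2p^r, p) + 15·σ_6^{(2)}(2p^r, p) + 10·σ_6^{(3)}(2p^r, p) ≡ 10·B_{p−3}^2·p^{r−1} (mod p^r). -/
open Finset

attribute [local instance] Classical.propDecidable

namespace S16
open PowerSeries

/-- generating series of `1/l`, `p ∤ l`, over `ℚ` -/
noncomputable def fQ (p : ℕ) : ℚ⟦X⟧ :=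
  PowerSeries.mk fun l => if 0 < l ∧ ¬ p ∣ l then (l : ℚ)⁻¹ else 0

lemma coeff_prod_tuple {R : Type*} [CommRing R] (n N : ℕ) (F : Fin n → R⟦X⟧) :
    coeff N (∏ i, F i) = ∑ l ∈ Finset.Nat.antidiagonalTuple n N, ∏ i, coeff (l i) (F i) := by
  classical
  rw [← Finset.piAntidiag_univ_fin_eq_antidiagonalTuple, PowerSeries.coeff_prod]
  refine Finset.sum_nbij' (fun l => (l : Fin n → ℕ)) (fun l => Finsupp.equivFunOnFinite.symm l)
    ?_ ?_ ?_ ?_ ?_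
  · intro a ha
    simpa using ha
  · intro a ha
    simpa using ha
  · intro a _; ext; simp
  · intro a _; ext; simp
  · intro a _; rfl

lemma sigma_eq (p n b N : ℕ) :
    sigmaSum p n b N = coeff N (∏ i : Fin n,
      if (i : ℕ) < b then rescale (-1 : ℚ) (fQ p) else fQ p) := by
  rw [coeff_prod_tuple, sigmaSum, Finset.sum_filter]
  refine Finset.sum_congr rfl fun l _ => ?_
  split_ifs with h
  · rw [← Finset.prod_pow_eq_pow_sum, Finset.prod_filter, ← Finset.prod_mul_distrib]
    refine Finset.prod_congr rfl fun i _ => ?_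
    split_ifs with hi
    · simp [fQ, h i]
    · simp [fQ, h i]
  · push Not at h
    obtain ⟨i, hi⟩ := h
    symm
    apply Finset.prod_eq_zero (Finset.mem_univ i)
    have : ¬ (0 < l i ∧ ¬ p ∣ l i) := by
      rintro ⟨h1, h2⟩; exact h2 (hi h1)
    split_ifs <;> simp [fQ, this]

lemma f_add_g (p : ℕ) (hp : p.Prime) (hp2 : p ≠ 2) :
    fQ p + rescale (-1 : ℚ) (fQ p) = expand 2 two_ne_zero (fQ p) := by
  ext n
  rw [coeff_expand]
  rcases Nat.even_or_odd n with h | h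
  · obtain ⟨k, rfl⟩ := h
    have h1 : (p ∣ k + k) ↔ p ∣ k := by
      rw [← two_mul]
      constructor
      · intro hh
        rcases (hp.dvd_mul).1 hh with h | h
        · exact absurd ((Nat.prime_dvd_prime_iff_eq hp Nat.prime_two).1 h) hp2
        · exact h
      · intro hh; exact Dvd.dvd.mul_left hh 2
    have h3 : (k + k) / 2 = k := by omega
    have h2 : 2 ∣ k + k := by omega
    have h4 : (0 < k + k ∧ ¬ p ∣ k + k) ↔ (0 < k ∧ ¬ p ∣ k) := by
      rw [h1]; simp
    simp only [map_add, coeff_rescale, fQ, coeff_mk, h3, h2, if_true, h4]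
    split_ifs with h
    · have : (k : ℚ) ≠ 0 := by exact_mod_cast h.1.ne'
      rw [show (-1 : ℚ) ^ (k + k) = 1 from Even.neg_one_pow ⟨k, rfl⟩]
      push_cast
      field_simp
      try norm_num
    · simp
  · have h2 : ¬ 2 ∣ n := by rw [← even_iff_two_dvd]; simpa using h
    simp [h2, h.neg_one_pow]

lemma lhs_eq (p : ℕ) (hp : p.Prime) (hp2 : p ≠ 2) (M : ℕ) :
    6 * sigmaSum p 6 1 (2 * M) + 15 * sigmaSum p 6 2 (2 * M) + 10 * sigmaSum p 6 3 (2 * M)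
      = 1 / 2 * coeff M (fQ p ^ 6) - coeff (2 * M) (fQ p ^ 6) := by
  simp only [sigma_eq]
  simp only [Fin.prod_univ_six]
  norm_num
  set f := fQ p
  set g := rescale (-1 : ℚ) f with hg
  have hev : ∀ h : ℚ⟦X⟧, coeff (2 * M) (rescale (-1 : ℚ) h) = coeff (2 * M) h := by
    intro h
    rw [coeff_rescale, Even.neg_one_pow ⟨M, by ring⟩, one_mul]
  have hgg : rescale (-1 : ℚ) g = f := by
    ext n; simp only [hg, coeff_rescale, ← mul_assoc, ← mul_pow]; norm_num
  have h6 : coeff M (f ^ 6) = coeff (2 * M) ((f + g) ^ 6) := by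
    rw [f_add_g p hp hp2, ← map_pow, coeff_expand_mul]
  have e0 := hev (f ^ 6)
  have e1 := hev (f ^ 5 * g)
  have e2 := hev (f ^ 4 * g ^ 2)
  simp only [map_mul, map_pow, hgg, ← hg] at e0 e1 e2
  have hx : (f + g) ^ 6 = f ^ 6 + g ^ 6 + (6 : ℚ) • (f ^ 5 * g) + (6 : ℚ) • (g ^ 5 * f)
      + (15 : ℚ) • (f ^ 4 * g ^ 2) + (15 : ℚ) • (g ^ 4 * f ^ 2) + (20 : ℚ) • (f ^ 3 * g ^ 3) := by
    simp only [smul_eq_C_mul]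
    rw [show (C (6 : ℚ) : ℚ⟦X⟧) = 6 from map_ofNat _ _, show (C (15 : ℚ) : ℚ⟦X⟧) = 15 from map_ofNat _ _,
      show (C (20 : ℚ) : ℚ⟦X⟧) = 20 from map_ofNat _ _]
    ring
  rw [h6, hx]
  simp only [map_add, map_smul, smul_eq_mul]
  rw [e0, e1, e2]
  rw [show g * f * f * f * f * f = f ^ 5 * g by ring, show g * g * f * f * f * f = f ^ 4 * g ^ 2 by ring,
    show g * g * g * f * f * f = f ^ 3 * g ^ 3 by ring]
  ring

end S16

namespace S16
open PowerSeries

section red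
variable (p : ℕ) [hpf : Fact p.Prime]

/-- inverse of a natural number in `ℤ_[p]` -/
noncomputable def pinv (l : ℕ) : ℤ_[p] := Ring.inverse (l : ℤ_[p])

lemma isUnit_nat {l : ℕ} (h : ¬ p ∣ l) : IsUnit (l : ℤ_[p]) := by
  rw [PadicInt.isUnit_iff]
  by_contra hne
  have h1 : ‖((l : ℤ) : ℤ_[p])‖ < 1 := lt_of_le_of_ne (PadicInt.norm_le_one _) (by simpa using hne)
  rw [PadicInt.norm_intCast_lt_one_iff] at h1
  exact h (by exact_mod_cast h1)

lemma mul_pinv {l : ℕ} (h : ¬ p ∣ l) : (l : ℤ_[p]) * pinv p l = 1 :=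
  Ring.mul_inverse_cancel _ (isUnit_nat p h)

noncomputable def fR : ℤ_[p]⟦X⟧ := PowerSeries.mk fun l => if p ∣ l then 0 else pinv p l

noncomputable def fr (q : ℕ) : ℤ_[p]⟦X⟧ :=
  PowerSeries.mk fun l => if l < q ∧ ¬ p ∣ l then pinv p l else 0

noncomputable def gr (q : ℕ) : ℤ_[p]⟦X⟧ :=
  PowerSeries.mk fun l => if l < q ∧ ¬ p ∣ l then pinv p l ^ 2 else 0

lemma C_dvd_of_coeff {R : Type*} [CommRing R] (c : R) (h : R⟦X⟧) (H : ∀ n, c ∣ coeff n h) :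
    C c ∣ h := by
  choose g hg using H
  refine ⟨PowerSeries.mk g, ?_⟩
  ext n
  simp [hg]

lemma coeff_of_C_dvd {R : Type*} [CommRing R] (c : R) (h : R⟦X⟧) (H : C c ∣ h) (n : ℕ) :
    c ∣ coeff n h := by
  obtain ⟨g, rfl⟩ := H
  simp

lemma coeff_mul_expand {R : Type*} [CommRing R] (q : ℕ) (hq : q ≠ 0) (s φ : R⟦X⟧)
    (hs : ∀ l, q ≤ l → coeff l s = 0) (n : ℕ) :
    coeff n (s * expand q hq φ) = coeff (n % q) s * coeff (n / q) φ := by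
  rw [coeff_mul, Finset.sum_eq_single (n % q, q * (n / q))]
  · simp
  · rintro ⟨a, b⟩ hab hne
    simp only [HasAntidiagonal.mem_antidiagonal] at hab
    by_cases ha : q ≤ a
    · simp [hs a ha]
    · rw [coeff_expand]
      split_ifs with hb
      · exfalso
        obtain ⟨c, rfl⟩ := hb
        push Not at ha
        apply hne
        have h1 : n % q = a := by
          rw [← hab, Nat.add_mul_mod_self_left, Nat.mod_eq_of_lt ha]
        have h2 : n / q = c := by
          rw [← hab, Nat.add_mul_div_left _ _ (Nat.pos_of_ne_zero hq), Nat.div_eq_of_lt ha, zero_add]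
        simp [h1, h2]
      · simp
  · intro h
    simp [Nat.mod_add_div] at h

lemma coeff_mul_expand_mul {R : Type*} [CommRing R] (q : ℕ) (hq : q ≠ 0) (s φ : R⟦X⟧) (n : ℕ) :
    coeff (q * n) (expand q hq φ * s) =
      ∑ jk ∈ antidiagonal n, coeff jk.1 φ * coeff (q * jk.2) s := by
  rw [coeff_mul]
  symm
  apply Finset.sum_of_injOn (fun jk : ℕ × ℕ => (q * jk.1, q * jk.2))
  · rintro ⟨a, b⟩ _ ⟨c, d⟩ _ h
    simp only [Prod.mk.injEq, mul_eq_mul_left_iff, hq, or_false] at h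
    simp [h]
  · rintro ⟨a, b⟩ h
    simp at h
    simp [← h, mul_add]
  · rintro ⟨a, b⟩ h hn
    simp only [HasAntidiagonal.mem_antidiagonal] at h
    rw [coeff_expand]
    split_ifs with hd
    · exfalso
      obtain ⟨c, rfl⟩ := hd
      have : q ∣ b := by
        rw [← Nat.dvd_add_right (Dvd.intro c rfl), h]; exact Dvd.intro n rfl
      obtain ⟨d, rfl⟩ := this
      apply hn
      refine ⟨(c, d), ?_, rfl⟩
      rw [← mul_add] at h
      simpa using Nat.eq_of_mul_eq_mul_left (Nat.pos_of_ne_zero hq) h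
    · simp
  · rintro ⟨a, b⟩ _
    simp

/-- second-order expansion of `fR` -/
lemma fR_expand (r : ℕ) (hr : 1 ≤ r) (hq : p ^ r ≠ 0) :
    C ((p : ℤ_[p]) ^ r * (p : ℤ_[p]) ^ r) ∣ fR p -
      (fr p (p ^ r) * expand (p ^ r) hq (PowerSeries.mk 1)
        - C ((p : ℤ_[p]) ^ r) * (gr p (p ^ r) * expand (p ^ r) hq (PowerSeries.mk fun n => (n : ℤ_[p])))) := by
  apply C_dvd_of_coeff
  intro n
  rw [map_sub, map_sub, coeff_C_mul, coeff_mul_expand, coeff_mul_expand]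
  · simp only [fR, fr, gr, coeff_mk]
    have hlt : n % p ^ r < p ^ r := Nat.mod_lt _ (Nat.pos_of_ne_zero hq)
    have hd : p ∣ n % p ^ r ↔ p ∣ n := by
      rw [Nat.dvd_mod_iff (dvd_pow_self p (by omega))]
    simp only [hlt, true_and, hd]
    by_cases h : p ∣ n
    · simp [h]
    · simp only [h, not_false_eq_true, if_true, if_false, Pi.one_apply, mul_one]
      have h1 := mul_pinv p h
      have h2 := mul_pinv p (mt hd.1 h)
      have h3 : (n : ℤ_[p]) = ((n % p ^ r : ℕ) : ℤ_[p]) + (p : ℤ_[p]) ^ r * ((n / p ^ r : ℕ) : ℤ_[p]) := by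
        conv_lhs => rw [← Nat.mod_add_div n (p ^ r)]
        push_cast; ring
      set x := pinv p n
      set y := pinv p (n % p ^ r)
      set a : ℤ_[p] := ((n / p ^ r : ℕ) : ℤ_[p])
      set t : ℤ_[p] := ((n % p ^ r : ℕ) : ℤ_[p])
      set Q := (p : ℤ_[p]) ^ r
      refine ⟨x * a ^ 2 * y ^ 2, ?_⟩
      rw [h3] at h1
      linear_combination (y - Q * a * y ^ 2) * h1 + (Q * a * x * y - x) * h2
  · intro l hl; simp [gr, hl.not_gt]
  · intro l hl; simp [fr, hl.not_gt]

lemma mk_id_eq {R : Type*} [CommRing R] :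
    (PowerSeries.mk fun n => (n : R)) = X * (PowerSeries.mk 1 : R⟦X⟧) ^ 2 := by
  rw [mk_one_pow_eq_mk_choose_add R 1]
  ext n
  cases n with
  | zero => simp
  | succ n => rw [coeff_succ_X_mul]; simp [add_comm]

lemma mk_five_id {R : Type*} [CommRing R] :
    (PowerSeries.mk 1 : R⟦X⟧) ^ 5 * (PowerSeries.mk fun n => (n : R))
      = PowerSeries.mk fun n => ((n + 5).choose 6 : R) := by
  rw [mk_id_eq, show (PowerSeries.mk 1 : R⟦X⟧) ^ 5 * (X * (PowerSeries.mk 1 : R⟦X⟧) ^ 2)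
    = X * (PowerSeries.mk 1 : R⟦X⟧) ^ (6 + 1) by ring, mk_one_pow_eq_mk_choose_add R 6]
  ext n
  cases n with
  | zero => simp
  | succ n => rw [coeff_succ_X_mul]; simp only [coeff_mk]; congr 2; omega

lemma coeff_vanish_mul {R : Type*} [CommRing R] (a b : ℕ) (s t : R⟦X⟧)
    (hs : ∀ l, a < l → coeff l s = 0) (ht : ∀ l, b < l → coeff l t = 0) :
    ∀ l, a + b < l → coeff l (s * t) = 0 := by
  intro l hl
  rw [coeff_mul]
  apply Finset.sum_eq_zero
  rintro ⟨i, j⟩ hij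
  simp only [HasAntidiagonal.mem_antidiagonal] at hij
  by_cases h : a < i
  · simp [hs i h]
  · have : b < j := by omega
    simp [ht j this]

lemma coeff_vanish_pow {R : Type*} [CommRing R] (a n : ℕ) (s : R⟦X⟧)
    (hs : ∀ l, a < l → coeff l s = 0) :
    ∀ l, n * a < l → coeff l (s ^ n) = 0 := by
  induction n with
  | zero => intro l hl; simp [coeff_one]; omega
  | succ n ih =>
    rw [pow_succ]
    intro l hl
    apply coeff_vanish_mul (n * a) a _ _ ih hs
    rw [add_mul] at hl; omega

/-- bounded sums -/
noncomputable def Sk (q k : ℕ) : ℤ_[p] := coeff (q * k) (fr p q ^ 6)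
noncomputable def Tk (q k : ℕ) : ℤ_[p] := coeff (q * k) (fr p q ^ 5 * gr p q)

lemma Sk_zero (q : ℕ) : Sk p q 0 = 0 := by
  simp [Sk, fr]

lemma Tk_zero (q : ℕ) : Tk p q 0 = 0 := by
  simp [Tk, fr]

lemma Sk_big (q k : ℕ) (hq : 0 < q) (hk : 6 ≤ k) : Sk p q k = 0 := by
  apply coeff_vanish_pow (q - 1)
  · intro l hl; simp [fr]; intro h; omega
  · calc 6 * (q - 1) < 6 * q := by omega
      _ ≤ k * q := by gcongr
      _ = q * k := mul_comm _ _

lemma Tk_big (q k : ℕ) (hq : 0 < q) (hk : 6 ≤ k) : Tk p q k = 0 := by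
  apply coeff_vanish_mul (5 * (q - 1)) (q - 1)
  · apply coeff_vanish_pow
    intro l hl; simp [fr]; intro h; omega
  · intro l hl; simp [gr]; intro h; omega
  · calc 5 * (q - 1) + (q - 1) < 6 * q := by omega
      _ ≤ k * q := by gcongr
      _ = q * k := mul_comm _ _

lemma sum_anti {R : Type*} [CommRing R] (n : ℕ) (hn : 5 ≤ n) (c S : ℕ → R) (h0 : S 0 = 0)
    (h6 : ∀ k, 6 ≤ k → S k = 0) :
    ∑ jk ∈ antidiagonal n, c jk.1 * S jk.2 =
      c (n - 1) * S 1 + c (n - 2) * S 2 + c (n - 3) * S 3 + c (n - 4) * S 4 + c (n - 5) * S 5 := by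
  rw [← Finset.Nat.sum_antidiagonal_swap]
  simp only [Prod.fst_swap, Prod.snd_swap]
  rw [Finset.Nat.sum_antidiagonal_eq_sum_range_succ (fun i j => c j * S i)]
  rw [show n.succ = 6 + (n - 5) by omega, Finset.sum_range_add]
  rw [Finset.sum_eq_zero (s := Finset.range (n - 5))]
  · simp [Finset.sum_range_succ, h0]
  · intro x _; rw [h6 _ (by omega), mul_zero]

/-- `Z_6(N)` in `ℤ_[p]` -/
noncomputable def ZR (N : ℕ) : ℤ_[p] := coeff N (fR p ^ 6)

lemma ZR_expand (r : ℕ) (hr : 1 ≤ r) (n : ℕ) :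
    (p : ℤ_[p]) ^ (r + r) ∣ ZR p (p ^ r * n) -
      (∑ jk ∈ antidiagonal n, ((5 + jk.1).choose 5 : ℤ_[p]) * Sk p (p ^ r) jk.2
        - 6 * (p : ℤ_[p]) ^ r * ∑ jk ∈ antidiagonal n, ((jk.1 + 5).choose 6 : ℤ_[p]) * Tk p (p ^ r) jk.2) := by
  have hq : p ^ r ≠ 0 := pow_ne_zero _ hpf.out.ne_zero
  have h1 := fR_expand p r hr hq
  set f := fR p
  set F := fr p (p ^ r) with hF
  set G := gr p (p ^ r) with hG
  set E := expand (p ^ r) hq (PowerSeries.mk 1 : ℤ_[p]⟦X⟧) with hE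
  set E' := expand (p ^ r) hq (PowerSeries.mk fun n => (n : ℤ_[p])) with hE'
  set c := C ((p : ℤ_[p]) ^ r) with hc
  rw [map_mul] at h1
  obtain ⟨v, hv⟩ := h1
  have hf : f = F * E - c * (G * E') + c * c * v := by linear_combination hv
  have h2 : c * c ∣ f ^ 6 - (F ^ 6 * E ^ 6 - 6 * c * (F ^ 5 * G) * (E ^ 5 * E')) := by
    rw [hf]
    set A := F * E with hA
    set B := G * E'
    have : (A - c * B + c * c * v) ^ 6 - (A ^ 6 - 6 * c * A ^ 5 * B) =
      ((A + c * (-B + c * v)) ^ 6 - A ^ 6 - 6 * A ^ 5 * (c * (-B + c * v))) + c * c * (6 * A ^ 5 * v) := by ring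
    rw [show F ^ 6 * E ^ 6 - 6 * c * (F ^ 5 * G) * (E ^ 5 * E') = A ^ 6 - 6 * c * A ^ 5 * B by
      simp only [A, B]; ring, this]
    refine dvd_add ?_ (dvd_mul_right _ _)
    set D := -B + c * v
    exact ⟨D ^ 2 * (15 * A ^ 4 + 20 * A ^ 3 * (c * D) + 15 * A ^ 2 * (c * D) ^ 2
      + 6 * A * (c * D) ^ 3 + (c * D) ^ 4), by ring⟩
  have e6 : E ^ 6 = expand (p ^ r) hq (PowerSeries.mk fun n => ((5 + n).choose 5 : ℤ_[p])) := by
    rw [hE, ← map_pow, ← mk_one_pow_eq_mk_choose_add ℤ_[p] 5]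
  have e7 : E ^ 5 * E' = expand (p ^ r) hq (PowerSeries.mk fun n => ((n + 5).choose 6 : ℤ_[p])) := by
    rw [hE, hE', ← map_pow, ← map_mul, mk_five_id]
  rw [e6, e7, hc, ← map_mul] at h2
  have h3 := coeff_of_C_dvd _ _ h2 (p ^ r * n)
  rw [map_sub, map_sub, mul_comm (F ^ 6), coeff_mul_expand_mul,
    show 6 * C ((p : ℤ_[p]) ^ r) * (F ^ 5 * G) * (expand (p ^ r) hq)
      (PowerSeries.mk fun n => ((n + 5).choose 6 : ℤ_[p])) =
      C (6 * (p : ℤ_[p]) ^ r) * ((expand (p ^ r) hq)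
      (PowerSeries.mk fun n => ((n + 5).choose 6 : ℤ_[p])) * (F ^ 5 * G)) by
      rw [map_mul, map_ofNat]; ring, coeff_C_mul, coeff_mul_expand_mul] at h3
  rw [pow_add]
  simpa [ZR, Sk, Tk] using h3

end red
end S16

namespace S16
open PowerSeries

section red2
variable (p : ℕ) [hpf : Fact p.Prime]

noncomputable def Dl (q : ℕ) : ℤ_[p] :=
  12 * Sk p q 1 - 3 * Sk p q 2 + 2 * Sk p q 3 - 3 * Sk p q 4 + 12 * Sk p q 5

lemma choose5 {R : Type*} [CommRing R] (x : ℕ) :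
    (120 : R) * ((x + 4).choose 5 : R) = (x + 4) * (x + 3) * (x + 2) * (x + 1) * x := by
  have h := Nat.descFactorial_eq_factorial_mul_choose (x + 4) 5
  simp only [Nat.descFactorial, Nat.factorial] at h
  simp only [show x + 4 - 4 = x by omega, show x + 4 - 3 = x + 1 by omega,
    show x + 4 - 2 = x + 2 by omega, show x + 4 - 1 = x + 3 by omega, Nat.sub_zero] at h
  have h2 := congrArg (Nat.cast (R := R)) h
  push_cast at h2
  linear_combination -h2

lemma choose6 {R : Type*} [CommRing R] (x : ℕ) :
    (720 : R) * ((x + 5).choose 6 : R) = (x + 5) * (x + 4) * (x + 3) * (x + 2) * (x + 1) * x := by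
  have h := Nat.descFactorial_eq_factorial_mul_choose (x + 5) 6
  simp only [Nat.descFactorial, Nat.factorial] at h
  simp only [show x + 5 - 5 = x by omega, show x + 5 - 4 = x + 1 by omega, show x + 5 - 3 = x + 2 by omega,
    show x + 5 - 2 = x + 3 by omega, show x + 5 - 1 = x + 4 by omega, Nat.sub_zero] at h
  have h2 := congrArg (Nat.cast (R := R)) h
  push_cast at h2
  linear_combination -h2

lemma isUnit_of_lt (h7 : 7 < p) (n : ℕ) (hn : ∀ q, q.Prime → q ∣ n → q ≤ 7) :
    IsUnit (n : ℤ_[p]) := by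
  apply isUnit_nat
  intro h
  exact absurd (hn p hpf.out h) (by omega)

lemma isUnit_two (h7 : 7 < p) : IsUnit (2 : ℤ_[p]) := by
  have := isUnit_nat p (l := 2) (fun h => absurd (Nat.le_of_dvd (by norm_num) h) (by omega))
  exact_mod_cast this

lemma isUnit_three (h7 : 7 < p) : IsUnit (3 : ℤ_[p]) := by
  have := isUnit_nat p (l := 3) (fun h => absurd (Nat.le_of_dvd (by norm_num) h) (by omega))
  exact_mod_cast this

lemma isUnit_five (h7 : 7 < p) : IsUnit (5 : ℤ_[p]) := by
  have := isUnit_nat p (l := 5) (fun h => absurd (Nat.le_of_dvd (by norm_num) h) (by omega))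
  exact_mod_cast this

lemma isUnit_60 (h7 : 7 < p) : IsUnit (60 : ℤ_[p]) := by
  rw [show (60 : ℤ_[p]) = 2 * 2 * 3 * 5 by norm_num]
  exact (((isUnit_two p h7).mul (isUnit_two p h7)).mul (isUnit_three p h7)).mul (isUnit_five p h7)

lemma isUnit_720 (h7 : 7 < p) : IsUnit (720 : ℤ_[p]) := by
  rw [show (720 : ℤ_[p]) = 60 * 2 * 2 * 3 by norm_num]
  exact (((isUnit_60 p h7).mul (isUnit_two p h7)).mul (isUnit_two p h7)).mul (isUnit_three p h7)

lemma stepA (h7 : 7 < p) (r : ℕ) (hr : 1 ≤ r) (hS : ∀ k, (p : ℤ_[p]) ^ (r - 1) ∣ Sk p (p ^ r) k) (M : ℕ) :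
    (p : ℤ_[p]) ^ (r + 1) ∣ 60 * ZR p (p ^ (r + 1) * M) - M * p * Dl p (p ^ r) := by
  rcases Nat.eq_zero_or_pos M with rfl | hM
  · simp [ZR, fR]
  have hqpos : 0 < p ^ r := pow_pos hpf.out.pos _
  set m := p * M with hm
  have hm5 : 5 < m := lt_of_lt_of_le (by omega) (Nat.le_mul_of_pos_right p hM)
  have h1 := ZR_expand p r hr m
  rw [sum_anti m (by omega) (fun j => ((5 + j).choose 5 : ℤ_[p])) (Sk p (p ^ r)) (Sk_zero p _)
      (fun k hk => Sk_big p _ k hqpos hk),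
    sum_anti m (by omega) (fun j => ((j + 5).choose 6 : ℤ_[p])) (Tk p (p ^ r)) (Tk_zero p _)
      (fun k hk => Tk_big p _ k hqpos hk)] at h1
  have h2 : (p : ℤ_[p]) ^ (r + 1) ∣ (p : ℤ_[p]) ^ (r + r) := pow_dvd_pow _ (by omega)
  obtain ⟨z, hz⟩ := h2.trans h1
  rw [hm, ← mul_assoc, ← pow_succ] at hz
  rw [← hm] at hz
  clear_value m
  obtain ⟨x, rfl⟩ : ∃ x, m = x + 5 := ⟨m - 5, by omega⟩
  have a1 := choose5 (R := ℤ_[p]) (x + 5)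
  have a2 := choose5 (R := ℤ_[p]) (x + 4)
  have a3 := choose5 (R := ℤ_[p]) (x + 3)
  have a4 := choose5 (R := ℤ_[p]) (x + 2)
  have a5 := choose5 (R := ℤ_[p]) (x + 1)
  have b1 := choose6 (R := ℤ_[p]) (x + 4)
  have b2 := choose6 (R := ℤ_[p]) (x + 3)
  have b3 := choose6 (R := ℤ_[p]) (x + 2)
  have b4 := choose6 (R := ℤ_[p]) (x + 1)
  have b5 := choose6 (R := ℤ_[p]) x
  simp only [show 5 + (x + 5 - 1) = x + 5 + 4 by omega, show 5 + (x + 5 - 2) = x + 4 + 4 by omega,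
    show 5 + (x + 5 - 3) = x + 3 + 4 by omega, show 5 + (x + 5 - 4) = x + 2 + 4 by omega,
    show 5 + (x + 5 - 5) = x + 1 + 4 by omega, show x + 5 - 1 + 5 = x + 4 + 5 by omega,
    show x + 5 - 2 + 5 = x + 3 + 5 by omega, show x + 5 - 3 + 5 = x + 2 + 5 by omega,
    show x + 5 - 4 + 5 = x + 1 + 5 by omega, show x + 5 - 5 + 5 = x + 5 by omega] at hz
  have hmc : (x : ℤ_[p]) = p * M - 5 := by
    have := congrArg (Nat.cast (R := ℤ_[p])) hm
    push_cast at this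
    linear_combination this
  push_cast at a1 a2 a3 a4 a5 b1 b2 b3 b4 b5
  rw [hmc] at a1 a2 a3 a4 a5 b1 b2 b3 b4 b5
  rw [← (isUnit_720 p h7).dvd_mul_left]
  obtain ⟨s1, hs1⟩ := hS 1
  obtain ⟨s2, hs2⟩ := hS 2
  obtain ⟨s3, hs3⟩ := hS 3
  obtain ⟨s4, hs4⟩ := hS 4
  obtain ⟨s5, hs5⟩ := hS 5
  have hpp : (p : ℤ_[p]) ^ (r + 1) = (p : ℤ_[p]) ^ (r - 1) * p ^ 2 := by
    rw [← pow_add]; congr 1; omega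
  have hpp2 : (p : ℤ_[p]) ^ r = (p : ℤ_[p]) ^ (r - 1) * p := by
    rw [← pow_succ]; congr 1; omega
  rw [Dl]
  generalize ((x + 5 + 4).choose 5 : ℤ_[p]) = A1 at *
  generalize ((x + 4 + 4).choose 5 : ℤ_[p]) = A2 at *
  generalize ((x + 3 + 4).choose 5 : ℤ_[p]) = A3 at *
  generalize ((x + 2 + 4).choose 5 : ℤ_[p]) = A4 at *
  generalize ((x + 1 + 4).choose 5 : ℤ_[p]) = A5 at *
  generalize ((x + 4 + 5).choose 6 : ℤ_[p]) = B1 at *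
  generalize ((x + 3 + 5).choose 6 : ℤ_[p]) = B2 at *
  generalize ((x + 2 + 5).choose 6 : ℤ_[p]) = B3 at *
  generalize ((x + 1 + 5).choose 6 : ℤ_[p]) = B4 at *
  generalize ((x + 5).choose 6 : ℤ_[p]) = B5 at *
  rw [hs1, hs2, hs3, hs4, hs5] at hz ⊢
  rw [hpp] at hz ⊢
  rw [hpp2] at hz
  generalize ZR p (p ^ (r + 1) * M) = Z at *
  generalize (p : ℤ_[p]) ^ (r - 1) = P at *
  generalize Tk p (p ^ r) 1 = T1 at *
  generalize Tk p (p ^ r) 2 = T2 at *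
  generalize Tk p (p ^ r) 3 = T3 at *
  generalize Tk p (p ^ r) 4 = T4 at *
  generalize Tk p (p ^ r) 5 = T5 at *
  generalize (p : ℤ_[p]) = t at *
  generalize (M : ℤ_[p]) = y at *
  clear hs1 hs2 hs3 hs4 hs5 hmc hpp hpp2 h1 h2 hS
  refine ⟨43200 * z + 360 * y ^ 2 * (((t * y) ^ 3 + 10 * (t * y) ^ 2 + 35 * (t * y) + 50) * s1
    + ((t * y) ^ 3 + 5 * (t * y) ^ 2 + 5 * (t * y) - 5) * s2 + ((t * y) ^ 3 - 5 * (t * y)) * s3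
    + ((t * y) ^ 3 - 5 * (t * y) ^ 2 + 5 * (t * y) + 5) * s4
    + ((t * y) ^ 3 - 10 * (t * y) ^ 2 + 35 * (t * y) - 50) * s5)
    - 360 * y * ((t * y + 4) * (t * y + 3) * (t * y + 2) * (t * y + 1) * (t * y - 1) * T1
     + (t * y + 3) * (t * y + 2) * (t * y + 1) * (t * y - 1) * (t * y - 2) * T2
     + (t * y + 2) * (t * y + 1) * (t * y - 1) * (t * y - 2) * (t * y - 3) * T3
     + (t * y + 1) * (t * y - 1) * (t * y - 2) * (t * y - 3) * (t * y - 4) * T4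
     + (t * y - 1) * (t * y - 2) * (t * y - 3) * (t * y - 4) * (t * y - 5) * T5), ?_⟩
  linear_combination 43200 * hz + 360 * P * (s1 * a1 + s2 * a2 + s3 * a3 + s4 * a4 + s5 * a5)
    - 360 * P * t * (T1 * b1 + T2 * b2 + T3 * b3 + T4 * b4 + T5 * b5)

lemma stepB (r : ℕ) (hr : 1 ≤ r) (k : ℕ) :
    (p : ℤ_[p]) ^ r ∣ Sk p (p ^ r) k -
      ∑ ij ∈ antidiagonal k, coeff ij.1 ((1 - X : ℤ_[p]⟦X⟧) ^ 6) * ZR p (p ^ r * ij.2) := by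
  have hq : p ^ r ≠ 0 := pow_ne_zero _ hpf.out.ne_zero
  have h1 := fR_expand p r hr hq
  obtain ⟨v, hv⟩ := h1
  rw [map_mul] at hv
  set c := C ((p : ℤ_[p]) ^ r) with hc
  have hE : expand (p ^ r) hq (PowerSeries.mk 1 : ℤ_[p]⟦X⟧) * expand (p ^ r) hq (1 - X) = 1 := by
    rw [← map_mul, mk_one_mul_one_sub_eq_one, map_one]
  have h2 : c ∣ fr p (p ^ r) - expand (p ^ r) hq (1 - X) * fR p := by
    refine ⟨expand (p ^ r) hq (1 - X) * (gr p (p ^ r) * expand (p ^ r) hq (PowerSeries.mk fun n => (n : ℤ_[p])))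
      - expand (p ^ r) hq (1 - X) * c * v, ?_⟩
    linear_combination (-expand (p ^ r) hq (1 - X)) * hv - fr p (p ^ r) * hE
  have h3 := h2.trans (sub_dvd_pow_sub_pow _ _ 6)
  rw [mul_pow, ← map_pow] at h3
  have h4 := coeff_of_C_dvd _ _ h3 (p ^ r * k)
  rwa [map_sub, coeff_mul_expand_mul] at h4

lemma stepC (h7 : 7 < p) (r : ℕ) (hr : 1 ≤ r) (hS : ∀ k, (p : ℤ_[p]) ^ (r - 1) ∣ Sk p (p ^ r) k) :
    (∀ k, (p : ℤ_[p]) ^ r ∣ Sk p (p ^ (r + 1)) k) ∧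
      (p : ℤ_[p]) ^ (r + 1) ∣ Dl p (p ^ (r + 1)) - p * Dl p (p ^ r) := by
  have hD : (p : ℤ_[p]) ^ (r - 1) ∣ Dl p (p ^ r) := by
    unfold Dl
    refine dvd_add (dvd_sub (dvd_add (dvd_sub ?_ ?_) ?_) ?_) ?_ <;>
      exact Dvd.dvd.mul_left (hS _) _
  have hpD : (p : ℤ_[p]) ^ r ∣ p * Dl p (p ^ r) := by
    have h := mul_dvd_mul_left (p : ℤ_[p]) hD
    rwa [← pow_succ', show r - 1 + 1 = r by omega] at h
  have hle : (p : ℤ_[p]) ^ r ∣ (p : ℤ_[p]) ^ (r + 1) := pow_dvd_pow _ (by omega)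
  have hZ := stepA p h7 r hr hS
  have hB := stepB p (r + 1) (by omega)
  have hZd : ∀ M : ℕ, (p : ℤ_[p]) ^ r ∣ ZR p (p ^ (r + 1) * M) := by
    intro M
    rw [← (isUnit_60 p h7).dvd_mul_left]
    have h1 := hle.trans (hZ M)
    have h2 : (p : ℤ_[p]) ^ r ∣ M * p * Dl p (p ^ r) := by
      rw [mul_assoc]; exact Dvd.dvd.mul_left hpD _
    simpa using dvd_add h1 h2
  constructor
  · intro k
    have h1 := hle.trans (hB k)
    have h2 : (p : ℤ_[p]) ^ r ∣ ∑ ij ∈ antidiagonal k, coeff ij.1 ((1 - X : ℤ_[p]⟦X⟧) ^ 6) *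
        ZR p (p ^ (r + 1) * ij.2) :=
      Finset.dvd_sum fun ij _ => Dvd.dvd.mul_left (hZd _) _
    simpa using dvd_add h1 h2
  · rw [← (isUnit_60 p h7).dvd_mul_left]
    have hx : (1 - X : ℤ_[p]⟦X⟧) ^ 6 = 1 - (6 : ℤ_[p]) • X + (15 : ℤ_[p]) • X ^ 2 - (20 : ℤ_[p]) • X ^ 3
        + (15 : ℤ_[p]) • X ^ 4 - (6 : ℤ_[p]) • X ^ 5 + X ^ 6 := by
      simp only [smul_eq_C_mul, map_ofNat]
      ring
    have hB1 := hB 1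
    have hB2 := hB 2
    have hB3 := hB 3
    have hB4 := hB 4
    have hB5 := hB 5
    rw [Finset.Nat.sum_antidiagonal_eq_sum_range_succ (fun i j =>
      coeff i ((1 - X : ℤ_[p]⟦X⟧) ^ 6) * ZR p (p ^ (r + 1) * j)), hx] at hB1 hB2 hB3 hB4 hB5
    have hZ1 := hZ 1
    have hZ2 := hZ 2
    have hZ3 := hZ 3
    have hZ4 := hZ 4
    have hZ5 := hZ 5
    have hZ0 : ZR p 0 = 0 := by simp [ZR, fR]
    simp [Finset.sum_range_succ, coeff_X, coeff_X_pow, coeff_one, hZ0] at hB1 hB2 hB3 hB4 hB5 hZ1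
    push_cast at hZ2 hZ3 hZ4 hZ5
    simp only [Dl] at hZ1 hZ2 hZ3 hZ4 hZ5 ⊢
    obtain ⟨z1, hz1⟩ := hZ1
    obtain ⟨z2, hz2⟩ := hZ2
    obtain ⟨z3, hz3⟩ := hZ3
    obtain ⟨z4, hz4⟩ := hZ4
    obtain ⟨z5, hz5⟩ := hZ5
    obtain ⟨w1, hw1⟩ := hB1
    obtain ⟨w2, hw2⟩ := hB2
    obtain ⟨w3, hw3⟩ := hB3
    obtain ⟨w4, hw4⟩ := hB4
    obtain ⟨w5, hw5⟩ := hB5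
    refine ⟨60 * (12 * w1 - 3 * w2 + 2 * w3 - 3 * w4 + 12 * w5)
      + 12 * z1 - 3 * (z2 - 6 * z1) + 2 * (z3 - 6 * z2 + 15 * z1)
      - 3 * (z4 - 6 * z3 + 15 * z2 - 20 * z1)
      + 12 * (z5 - 6 * z4 + 15 * z3 - 20 * z2 + 15 * z1), ?_⟩
    linear_combination 60 * (12 * hw1 - 3 * hw2 + 2 * hw3 - 3 * hw4 + 12 * hw5)
      + 12 * hz1 - 3 * (hz2 - 6 * hz1) + 2 * (hz3 - 6 * hz2 + 15 * hz1)
      - 3 * (hz4 - 6 * hz3 + 15 * hz2 - 20 * hz1)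
      + 12 * (hz5 - 6 * hz4 + 15 * hz3 - 20 * hz2 + 15 * hz1)

lemma ind (h7 : 7 < p) (r : ℕ) :
    (∀ k, (p : ℤ_[p]) ^ r ∣ Sk p (p ^ (r + 1)) k) ∧
      (p : ℤ_[p]) ^ (r + 1) ∣ Dl p (p ^ (r + 1)) - p ^ r * Dl p p := by
  induction r with
  | zero => simp
  | succ r ih =>
    have h := stepC p h7 (r + 1) (by omega) (by simpa using ih.1)
    refine ⟨h.1, ?_⟩
    have h2 := mul_dvd_mul_left (p : ℤ_[p]) ih.2
    rw [← pow_succ'] at h2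
    have h3 := dvd_add h.2 h2
    convert h3 using 1
    ring

lemma main_red (h7 : 7 < p) (r : ℕ) (hr : 2 ≤ r) (M : ℕ) :
    (p : ℤ_[p]) ^ r ∣ 60 * ZR p (p ^ r * M) - M * p ^ (r - 1) * Dl p p := by
  obtain ⟨s, rfl⟩ : ∃ s, r = s + 1 + 1 := ⟨r - 2, by omega⟩
  have h := ind p h7 s
  have h1 := stepA p h7 (s + 1) (by omega) (by simpa using h.1) M
  have h2 := mul_dvd_mul_left (p : ℤ_[p]) h.2
  rw [← pow_succ'] at h2
  have h3 := dvd_add h1 (Dvd.dvd.mul_left h2 (M : ℤ_[p]))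
  convert h3 using 1
  simp only [Nat.add_sub_cancel]
  ring

end red2
end S16

namespace S16
open Polynomial

section poly
variable (p : ℕ) [hpf : Fact p.Prime]

/-- `∏_{l=1}^{p-1} (X + l)` -/
noncomputable def PP : ℤ[X] := ∏ l ∈ Finset.range (p - 1), (X + C ((l + 1 : ℕ) : ℤ))

lemma PP_map : (PP p).map (Int.castRingHom (ZMod p)) = X ^ (p - 1) - 1 := by
  have hp1 : 1 < p := hpf.out.one_lt
  have hA : (PP p).map (Int.castRingHom (ZMod p)) =
      ∏ l ∈ Finset.range (p - 1), (X + C ((l + 1 : ℕ) : ZMod p)) := by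
    simp [PP, Polynomial.map_prod]
  rw [hA]
  set A := ∏ l ∈ Finset.range (p - 1), (X + C ((l + 1 : ℕ) : ZMod p)) with hAdef
  have hmon : A.Monic := monic_prod_of_monic _ _ fun l _ => monic_X_add_C _
  have hdeg : A.degree = (p - 1 : ℕ) := by
    rw [hAdef, degree_prod]; simp only [degree_X_add_C]; simp
  have hB : (X ^ (p - 1) - 1 : (ZMod p)[X]).Monic := by
    simpa using monic_X_pow_sub_C (1 : ZMod p) (n := p - 1) (by omega)
  have hBd : (X ^ (p - 1) - 1 : (ZMod p)[X]).degree = (p - 1 : ℕ) := by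
    simpa using degree_X_pow_sub_C (n := p - 1) (by omega) (1 : ZMod p)
  apply Polynomial.eq_of_degree_sub_lt_of_eval_finset_eq (Finset.univ.erase (0 : ZMod p))
  · have : #(Finset.univ.erase (0 : ZMod p)) = p - 1 := by
      rw [Finset.card_erase_of_mem (Finset.mem_univ _), Finset.card_univ, ZMod.card]
    rw [this]
    have := degree_sub_lt_left (hdeg.trans hBd.symm) hmon.ne_zero (by rw [hmon.leadingCoeff, hB.leadingCoeff])
    rwa [hdeg] at this
  · intro x hx
    have hx0 : x ≠ 0 := by simpa using hx
    have h1 : eval x (X ^ (p - 1) - 1 : (ZMod p)[X]) = 0 := by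
      simp [ZMod.pow_card_sub_one_eq_one hx0]
    rw [h1, hAdef, eval_prod]
    have hv : 0 < (-x).val := by
      rw [ZMod.val_pos]; simpa using hx0
    have hlt := ZMod.val_lt (-x)
    apply Finset.prod_eq_zero (i := (-x).val - 1)
    · simp; omega
    · rw [Nat.sub_add_cancel hv]; simp

lemma PP_coeff_dvd (n : ℕ) (h1 : 1 ≤ n) (h2 : n < p - 1) : (p : ℤ) ∣ (PP p).coeff n := by
  rw [← ZMod.intCast_zmod_eq_zero_iff_dvd _ p]
  have := congrArg (fun f => coeff f n) (PP_map p)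
  simp only [coeff_map, coeff_sub, coeff_X_pow, coeff_one] at this
  rw [if_neg (by omega), if_neg (by omega)] at this
  simpa using this

lemma PP_symm (hp2 : p ≠ 2) (x : ℤ) : (PP p).eval (-p - x) = (PP p).eval x := by
  have hodd : Odd p := hpf.out.odd_of_ne_two hp2
  have hev : Even (p - 1) := by
    obtain ⟨k, hk⟩ := hodd; exact ⟨k, by omega⟩
  have hp1 : 1 < p := hpf.out.one_lt
  simp only [PP, eval_prod, eval_add, eval_X, eval_C]
  rw [← Finset.prod_range_reflect]
  have : ∀ j ∈ Finset.range (p - 1), (-(p : ℤ) - x + ((p - 1 - 1 - j + 1 : ℕ) : ℤ)) = -1 * (x + ((j + 1 : ℕ) : ℤ)) := by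
    intro j hj
    have : j < p - 1 := by simpa using hj
    have h : ((p - 1 - 1 - j + 1 : ℕ) : ℤ) = p - 1 - j := by omega
    rw [h]; push_cast; ring
  rw [Finset.prod_congr rfl this, Finset.prod_mul_distrib, Finset.prod_const, Finset.card_range,
    hev.neg_one_pow, one_mul]

/-- the expansion modulo `p^7` -/
lemma PP_eval_mod (h7 : 7 < p) (z : ℤ) :
    (p : ℤ) ^ 7 ∣ (PP p).eval (p * z) - ((PP p).coeff 0 + (PP p).coeff 1 * (p * z)
      + (PP p).coeff 2 * (p * z) ^ 2 + (PP p).coeff 3 * (p * z) ^ 3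
      + (PP p).coeff 4 * (p * z) ^ 4 + (PP p).coeff 5 * (p * z) ^ 5) := by
  have hp9 : 8 < p - 1 := by
    have h8 : p ≠ 8 := by rintro rfl; exact absurd hpf.out (by norm_num)
    have h9 : p ≠ 9 := by rintro rfl; exact absurd hpf.out (by norm_num)
    omega
  rw [eval_eq_sum_range' (n := 7 + ((PP p).natDegree + 1)) (by omega), Finset.sum_range_add]
  simp only [Finset.sum_range_succ _ 6, Finset.sum_range_succ _ 5, Finset.sum_range_succ _ 4,
    Finset.sum_range_succ _ 3, Finset.sum_range_succ _ 2, Finset.sum_range_succ _ 1, Finset.sum_range_one]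
  have h6 : (p : ℤ) ^ 7 ∣ (PP p).coeff 6 * (p * z) ^ 6 := by
    obtain ⟨y, hy⟩ := PP_coeff_dvd p 6 (by omega) (by omega)
    exact ⟨y * z ^ 6, by rw [hy]; ring⟩
  have h8 : (p : ℤ) ^ 7 ∣ ∑ x ∈ Finset.range ((PP p).natDegree + 1), (PP p).coeff (7 + x) * (p * z) ^ (7 + x) := by
    apply Finset.dvd_sum
    intro i _
    exact ⟨(PP p).coeff (7 + i) * p ^ i * z ^ (7 + i), by ring⟩
  obtain ⟨y, hy⟩ := dvd_add h6 h8
  refine ⟨y, ?_⟩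
  rw [← hy]
  ring

end poly
end S16

namespace S16

section modp7
variable (p : ℕ) [hpf : Fact p.Prime]

/-- `∏_{l=1}^{p-1} (pa + l)` -/
def VV (a : ℕ) : ℕ := ∏ l ∈ Finset.range (p - 1), (p * a + (l + 1))

lemma VV_eq (a : ℕ) : ((VV p a : ℕ) : ℤ) = (PP p).eval ((p : ℤ) * a) := by
  simp [VV, PP, Polynomial.eval_prod]

lemma VV_coprime (a : ℕ) : Nat.Coprime (VV p a) p := by
  unfold VV
  apply Nat.Coprime.prod_left
  intro l hl
  have hl' : l < p - 1 := by simpa using hl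
  rw [Nat.Coprime, Nat.gcd_comm, Nat.gcd_mul_left_add_right]
  exact Nat.coprime_of_lt_prime (by omega) (by omega) hpf.out

lemma fact_mul (j : ℕ) : (p * j).factorial = p ^ j * j.factorial * ∏ a ∈ Finset.range j, VV p a := by
  have hp0 : 0 < p := hpf.out.pos
  induction j with
  | zero => simp
  | succ j ih =>
    have h : (p * (j + 1)).factorial = (p * j).factorial * ((VV p j) * (p * (j + 1))) := by
      have h1 : p * (j + 1) = p * j + (p - 1) + 1 := by rw [mul_add]; omega
      have h2 : ∀ n, (p * j + n).factorial = (p * j).factorial * ∏ l ∈ Finset.range n, (p * j + (l + 1)) := by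
        intro n
        induction n with
        | zero => simp
        | succ n ihn => rw [Finset.prod_range_succ, ← add_assoc, Nat.factorial_succ, ihn]; ring
      have h3 : p * j + (p - 1) + 1 = p * j + ((p - 1) + 1) := rfl
      rw [h1, Nat.factorial_succ, h2, VV]; ring
    rw [h, ih, Finset.prod_range_succ, Nat.factorial_succ]; ring

lemma choose_VV (i d : ℕ) :
    (p * (i + d)).choose (p * i) * ((∏ a ∈ Finset.range i, VV p a) * (∏ a ∈ Finset.range d, VV p a))
      = (i + d).choose i * ∏ a ∈ Finset.range (i + d), VV p a := by
  have hp0 : 0 < p := hpf.out.pos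
  have h1 := Nat.add_choose_mul_factorial_mul_factorial (p * i) (p * d)
  rw [← Nat.choose_symm_add, ← mul_add] at h1
  have h2 := Nat.add_choose_mul_factorial_mul_factorial i d
  rw [← Nat.choose_symm_add] at h2
  rw [fact_mul p i, fact_mul p d, fact_mul p (i + d)] at h1
  have h3 : 0 < p ^ (i + d) * i.factorial * d.factorial := by positivity
  apply Nat.eq_of_mul_eq_mul_left h3
  calc _ = (p * (i + d)).choose (p * i) * (p ^ i * i.factorial * ∏ a ∈ Finset.range i, VV p a)
        * (p ^ d * d.factorial * ∏ a ∈ Finset.range d, VV p a) := by ring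
    _ = _ := by rw [h1, ← h2]; ring

lemma isUnit_zmod {n : ℕ} (h : n.Coprime p) (s : ℕ) : IsUnit (n : ZMod (p ^ s)) :=
  (ZMod.isUnit_iff_coprime _ _).2 (Nat.Coprime.pow_right s h)

lemma cop_small (h7 : 7 < p) {n : ℕ} (h0 : 0 < n) (hn : n < 8) : n.Coprime p :=
  (Nat.coprime_of_lt_prime (by omega) (by omega) hpf.out).symm

lemma VV_form (h7 : 7 < p) : ∃ c1 c2 : ZMod (p ^ 7), (∃ a, c1 = (p : ZMod (p ^ 7)) ^ 3 * a) ∧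
    (∃ b, c2 = (p : ZMod (p ^ 7)) ^ 5 * b) ∧
    ∀ a : ℕ, (VV p a : ZMod (p ^ 7)) = (VV p 0 : ZMod (p ^ 7)) *
      (1 + c1 * ((a : ZMod (p ^ 7)) ^ 2 + (a : ZMod (p ^ 7))) + c2 * ((a : ZMod (p ^ 7)) ^ 2 + (a : ZMod (p ^ 7))) ^ 2) := by
  have hp9 : 8 < p - 1 := by
    have h8 : p ≠ 8 := by rintro rfl; exact absurd hpf.out (by norm_num)
    have h9 : p ≠ 9 := by rintro rfl; exact absurd hpf.out (by norm_num)
    omega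
  have hE : ∀ z : ℤ, (((PP p).eval (p * z) : ℤ) : ZMod (p ^ 7)) = (PP p).coeff 0 + (PP p).coeff 1 * (p * z)
      + (PP p).coeff 2 * (p * z) ^ 2 + (PP p).coeff 3 * (p * z) ^ 3
      + (PP p).coeff 4 * (p * z) ^ 4 + (PP p).coeff 5 * (p * z) ^ 5 := by
    intro z
    have h := PP_eval_mod p h7 z
    have h' := (ZMod.intCast_zmod_eq_zero_iff_dvd _ (p ^ 7)).2 (by exact_mod_cast h)
    push_cast at h'
    linear_combination h'
  have hs : ∀ z : ℤ, (((PP p).eval (p * (-1 - z)) : ℤ) : ZMod (p ^ 7)) = ((PP p).eval (p * z) : ℤ) := by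
    intro z
    rw [← PP_symm p (by omega) (p * z)]
    congr 2; ring
  have s0 := hs 0
  have s1 := hs 1
  have s2 := hs 2
  rw [hE, hE] at s0 s1 s2
  obtain ⟨y2, hy2⟩ := PP_coeff_dvd p 2 (by omega) (by omega)
  obtain ⟨y4, hy4⟩ := PP_coeff_dvd p 4 (by omega) (by omega)
  have hy2' := congrArg (Int.cast (R := ZMod (p ^ 7))) hy2
  have hy4' := congrArg (Int.cast (R := ZMod (p ^ 7))) hy4
  have u2 : IsUnit ((2 : ℕ) : ZMod (p ^ 7)) := isUnit_zmod p (cop_small p h7 (by norm_num) (by norm_num)) 7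
  have u3 : IsUnit ((3 : ℕ) : ZMod (p ^ 7)) := isUnit_zmod p (cop_small p h7 (by norm_num) (by norm_num)) 7
  have u5 : IsUnit ((5 : ℕ) : ZMod (p ^ 7)) := isUnit_zmod p (cop_small p h7 (by norm_num) (by norm_num)) 7
  have hV : ∀ a : ℕ, (VV p a : ZMod (p ^ 7)) = (((PP p).eval (p * (a : ℤ)) : ℤ) : ZMod (p ^ 7)) := by
    intro a; rw [← VV_eq]; simp
  simp only [hE] at hV
  push_cast at s0 s1 s2 u2 u3 u5 hy2' hy4' hV
  generalize (((PP p).coeff 0 : ℤ) : ZMod (p ^ 7)) = e0 at *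
  generalize (((PP p).coeff 1 : ℤ) : ZMod (p ^ 7)) = e1 at *
  generalize (((PP p).coeff 2 : ℤ) : ZMod (p ^ 7)) = e2 at *
  generalize (((PP p).coeff 3 : ℤ) : ZMod (p ^ 7)) = e3 at *
  generalize (((PP p).coeff 4 : ℤ) : ZMod (p ^ 7)) = e4 at *
  generalize (((PP p).coeff 5 : ℤ) : ZMod (p ^ 7)) = e5 at *
  have hV0 : (VV p 0 : ZMod (p ^ 7)) = e0 := by rw [hV 0]; push_cast; ring
  have hu0 : IsUnit e0 := by rw [← hV0]; exact isUnit_zmod p (VV_coprime p 0) 7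
  obtain ⟨g, hg⟩ := hu0.exists_right_inv
  set P := (p : ZMod (p ^ 7))
  -- `X5 = 0`, `X3 = 2 X4`, `X2 = X1 + X4`
  have hx5 : P ^ 5 * e5 = 0 := by
    have : (2 * 2 * 2 * 3 * 5 : ZMod (p ^ 7)) * (P ^ 5 * e5) = (2 * 2 * 2 * 3 * 5) * 0 := by
      linear_combination 5 * s1 - s2 - 10 * s0
    exact (((((u2.mul u2).mul u2).mul u3).mul u5).mul_right_inj).1 this
  have hx3 : P ^ 3 * e3 = 2 * (P ^ 4 * e4) := by
    have : (2 * 3 : ZMod (p ^ 7)) * (P ^ 3 * e3) = (2 * 3) * (2 * (P ^ 4 * e4)) := by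
      linear_combination 3 * s0 - s1 - 30 * hx5
    exact ((u2.mul u3).mul_right_inj).1 this
  have hx2 : P ^ 2 * e2 = P * e1 + P ^ 4 * e4 := by
    linear_combination s0 + hx3 + hx5
  refine ⟨g * (P * e1), g * (P ^ 4 * e4), ⟨g * (y2 - P ^ 2 * y4), ?_⟩, ⟨g * y4, ?_⟩, ?_⟩
  · rw [hy4'] at hx2; rw [hy2'] at hx2
    linear_combination (-g) * hx2
  · rw [hy4']; ring
  · intro a
    rw [hV a, hV0]
    linear_combination (-(P * e1) * ((a : ZMod (p ^ 7)) ^ 2 + (a : ZMod (p ^ 7))) - P ^ 4 * e4 * ((a : ZMod (p ^ 7)) ^ 2 + (a : ZMod (p ^ 7))) ^ 2) * hg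
      + (a : ZMod (p ^ 7)) ^ 2 * hx2 + (a : ZMod (p ^ 7)) ^ 3 * hx3 + (a : ZMod (p ^ 7)) ^ 5 * hx5

end modp7
end S16

namespace S16

section Nalg
variable {R : Type*} [CommRing R]

lemma N_mul (c1 c2 : R) (h1 : c1 ^ 3 = 0) (h2 : c1 * c2 = 0) (h3 : c2 ^ 2 = 0) (x y z x' y' z' : R) :
    (1 + x * c1 + y * c2 + z * c1 ^ 2) * (1 + x' * c1 + y' * c2 + z' * c1 ^ 2) =
      1 + (x + x') * c1 + (y + y') * c2 + (z + z' + x * x') * c1 ^ 2 := by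
  linear_combination (x * y' + x' * y + (y * z' + y' * z) * c1) * h2
    + (x * z' + x' * z + z * z' * c1) * h1 + y * y' * h3

lemma N_div (c1 c2 : R) (h1 : c1 ^ 3 = 0) (h2 : c1 * c2 = 0) (h3 : c2 ^ 2 = 0) (x y z x' y' z' D n : R)
    (h : D * (1 + x * c1 + y * c2 + z * c1 ^ 2) = n * (1 + x' * c1 + y' * c2 + z' * c1 ^ 2)) :
    D = n * (1 + (x' - x) * c1 + (y' - y) * c2 + (z' - z - x * x' + x ^ 2) * c1 ^ 2) := by
  have ha := N_mul c1 c2 h1 h2 h3 x y z (-x) (-y) (x ^ 2 - z)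
  have hb := N_mul c1 c2 h1 h2 h3 x' y' z' (-x) (-y) (x ^ 2 - z)
  linear_combination (1 + -x * c1 + -y * c2 + (x ^ 2 - z) * c1 ^ 2) * h - D * ha + n * hb

end Nalg

/-- coefficient sequences -/
def xs : ℕ → ℤ | 0 => 0 | j + 1 => xs j + (j ^ 2 + j)
/-- coefficient sequences -/
def ys : ℕ → ℤ | 0 => 0 | j + 1 => ys j + (j ^ 2 + j) ^ 2
/-- coefficient sequences -/
def zs : ℕ → ℤ | 0 => 0 | j + 1 => zs j + xs j * (j ^ 2 + j)

section ch
variable (p : ℕ) [hpf : Fact p.Prime]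

lemma choose_form (h7 : 7 < p) : ∃ c1 c2 : ZMod (p ^ 7), (∃ a, c1 = (p : ZMod (p ^ 7)) ^ 3 * a) ∧
    (∃ b, c2 = (p : ZMod (p ^ 7)) ^ 5 * b) ∧ c1 ^ 3 = 0 ∧ c1 * c2 = 0 ∧ c2 ^ 2 = 0 ∧
    ∀ i d : ℕ, (((p * (i + d)).choose (p * i) : ℕ) : ZMod (p ^ 7)) = (((i + d).choose i : ℕ) : ZMod (p ^ 7)) *
      (1 + ((xs (i + d) - (xs i + xs d) : ℤ) : ZMod (p ^ 7)) * c1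
        + ((ys (i + d) - (ys i + ys d) : ℤ) : ZMod (p ^ 7)) * c2
        + ((zs (i + d) - (zs i + zs d + xs i * xs d) - (xs i + xs d) * xs (i + d) + (xs i + xs d) ^ 2 : ℤ) : ZMod (p ^ 7)) * c1 ^ 2) := by
  obtain ⟨c1, c2, ⟨a, ha⟩, ⟨b, hb⟩, hV⟩ := VV_form p h7
  have hp7 : (p : ZMod (p ^ 7)) ^ 7 = 0 := by
    have := ZMod.natCast_self (p ^ 7)
    push_cast at this; exact this
  have h1 : c1 ^ 3 = 0 := by
    rw [ha]; linear_combination (p : ZMod (p ^ 7)) ^ 2 * a ^ 3 * hp7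
  have h2 : c1 * c2 = 0 := by
    rw [ha, hb]; linear_combination (p : ZMod (p ^ 7)) * a * b * hp7
  have h3 : c2 ^ 2 = 0 := by
    rw [hb]; linear_combination (p : ZMod (p ^ 7)) ^ 3 * b ^ 2 * hp7
  refine ⟨c1, c2, ⟨a, ha⟩, ⟨b, hb⟩, h1, h2, h3, ?_⟩
  have hu : IsUnit (VV p 0 : ZMod (p ^ 7)) := isUnit_zmod p (VV_coprime p 0) 7
  have hW : ∀ j : ℕ, ((∏ a ∈ Finset.range j, VV p a : ℕ) : ZMod (p ^ 7)) = (VV p 0 : ZMod (p ^ 7)) ^ j *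
      (1 + (xs j : ZMod (p ^ 7)) * c1 + (ys j : ZMod (p ^ 7)) * c2 + (zs j : ZMod (p ^ 7)) * c1 ^ 2) := by
    intro j
    induction j with
    | zero => simp [xs, ys, zs]
    | succ j ih =>
      rw [Finset.prod_range_succ, Nat.cast_mul, ih, hV j]
      have := N_mul c1 c2 h1 h2 h3 (xs j) (ys j) (zs j) ((j : ZMod (p ^ 7)) ^ 2 + j) (((j : ZMod (p ^ 7)) ^ 2 + j) ^ 2) 0
      simp only [xs, ys, zs]
      push_cast
      linear_combination (VV p 0 : ZMod (p ^ 7)) ^ j * (VV p 0 : ZMod (p ^ 7)) * this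
  intro i d
  have hc := congrArg (Nat.cast (R := ZMod (p ^ 7))) (choose_VV p i d)
  rw [Nat.cast_mul, Nat.cast_mul, Nat.cast_mul, hW, hW, hW] at hc
  have hm := N_mul c1 c2 h1 h2 h3 (xs i) (ys i) (zs i) (xs d) (ys d) (zs d)
  have hc2 := (hu.pow (i + d)).mul_right_inj (b := (((p * (i + d)).choose (p * i) : ℕ) : ZMod (p ^ 7)) *
     (1 + ((xs i : ZMod (p ^ 7)) + xs d) * c1 + ((ys i : ZMod (p ^ 7)) + ys d) * c2 + ((zs i : ZMod (p ^ 7)) + zs d + xs i * xs d) * c1 ^ 2))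
     (c := ((i + d).choose i : ℕ) * (1 + (xs (i + d) : ZMod (p ^ 7)) * c1 + (ys (i + d) : ZMod (p ^ 7)) * c2 + (zs (i + d) : ZMod (p ^ 7)) * c1 ^ 2))
  have hc3 := hc2.1 (by
    rw [← hm]
    linear_combination hc)
  have := N_div c1 c2 h1 h2 h3 _ _ _ _ _ _ _ _ hc3
  push_cast
  exact this

end ch
end S16

namespace S16
open PowerSeries

section Qs
variable (p : ℕ) [hpf : Fact p.Prime]

/-- `(1 - X^p - (1-X)^p)/p` -/
noncomputable def QQ : ℤ⟦X⟧ :=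
  PowerSeries.mk fun l => if 0 < l ∧ l < p then (-1) ^ (l + 1) * ((p.choose l / p : ℕ) : ℤ) else 0

lemma coeff_one_sub_X_pow (n k : ℕ) :
    coeff k ((1 - X : ℤ⟦X⟧) ^ n) = (-1) ^ k * (n.choose k : ℤ) := by
  have h : (1 - X : ℤ⟦X⟧) ^ n = rescale (-1 : ℤ) ((((1 + Polynomial.X) ^ n : Polynomial ℤ)) : ℤ⟦X⟧) := by
    simp [sub_eq_add_neg, rescale_X]
  rw [h, coeff_rescale, Polynomial.coeff_coe, Polynomial.coeff_one_add_X_pow]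

lemma QQ_eq (hp2 : p ≠ 2) : C (p : ℤ) * QQ p = -(1 - X) ^ p + expand p hpf.out.ne_zero (1 - X) := by
  have hodd : Odd p := hpf.out.odd_of_ne_two hp2
  ext l
  rw [coeff_C_mul, map_add, map_neg, coeff_one_sub_X_pow]
  simp only [map_sub, map_one, expand_X, coeff_one, coeff_X_pow, QQ, coeff_mk]
  have hp0 := hpf.out.pos
  rcases Nat.eq_zero_or_pos l with rfl | hl
  · simp [hp0.ne]
  · rcases lt_trichotomy l p with h | h | h
    · rw [if_pos ⟨hl, h⟩, if_neg (by omega), if_neg (by omega)]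
      have hd : p ∣ p.choose l := hpf.out.dvd_choose_self (by omega) h
      have : ((p : ℤ)) * ((p.choose l / p : ℕ) : ℤ) = (p.choose l : ℤ) := by
        rw [← Nat.cast_mul, Nat.mul_div_cancel' hd]
      rw [pow_succ]
      linear_combination (-1) ^ l * (-1) * this
    · subst h
      simp [hodd.neg_one_pow, hl.ne']
    · rw [if_neg (by omega), if_neg (by omega), if_neg (by omega), Nat.choose_eq_zero_of_lt h]
      simp

lemma QQ_pow (hp2 : p ≠ 2) (n k : ℕ) : (p : ℤ) ^ n * coeff (p * k) (QQ p ^ n) =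
    ∑ j ∈ Finset.range (n + 1), (-1) ^ j * (n.choose j : ℤ) *
      ∑ ab ∈ antidiagonal k, ((-1) ^ ab.1 * ((n - j).choose ab.1 : ℤ)) *
        ((-1) ^ ab.2 * ((p * j).choose (p * ab.2) : ℤ)) := by
  have hodd : Odd p := hpf.out.odd_of_ne_two hp2
  rw [← coeff_C_mul, map_pow, ← mul_pow, QQ_eq p hp2, add_pow, map_sum]
  apply Finset.sum_congr rfl
  intro j _
  have h1 : (-(1 - X : ℤ⟦X⟧) ^ p) ^ j * (expand p hpf.out.ne_zero (1 - X)) ^ (n - j) * ((n.choose j : ℕ) : ℤ⟦X⟧)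
      = C ((-1) ^ j * (n.choose j : ℤ)) * (expand p hpf.out.ne_zero ((1 - X) ^ (n - j)) * (1 - X) ^ (p * j)) := by
    rw [neg_pow, ← pow_mul, map_pow, map_mul, map_pow, map_neg, map_one]
    simp only [map_natCast]
    ring
  rw [h1, coeff_C_mul, coeff_mul_expand_mul]
  congr 1
  apply Finset.sum_congr rfl
  rintro ⟨a, b⟩ _
  rw [coeff_one_sub_X_pow, coeff_one_sub_X_pow, pow_mul, hodd.neg_one_pow]

end Qs
end S16

namespace S16
open PowerSeries

section comb
variable (p : ℕ) [hpf : Fact p.Prime]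

lemma choose_form' (h7 : 7 < p) : ∃ c1 c2 : ZMod (p ^ 7), (∃ a, c1 = (p : ZMod (p ^ 7)) ^ 3 * a) ∧
    (∃ b, c2 = (p : ZMod (p ^ 7)) ^ 5 * b) ∧ c1 ^ 3 = 0 ∧ c1 * c2 = 0 ∧ c2 ^ 2 = 0 ∧
    ∀ j b : ℕ, (((p * j).choose (p * b) : ℕ) : ZMod (p ^ 7)) = ((j.choose b : ℕ) : ZMod (p ^ 7)) *
      (1 + ((xs j - (xs b + xs (j - b)) : ℤ) : ZMod (p ^ 7)) * c1
        + ((ys j - (ys b + ys (j - b)) : ℤ) : ZMod (p ^ 7)) * c2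
        + ((zs j - (zs b + zs (j - b) + xs b * xs (j - b)) - (xs b + xs (j - b)) * xs j + (xs b + xs (j - b)) ^ 2 : ℤ) : ZMod (p ^ 7)) * c1 ^ 2) := by
  obtain ⟨c1, c2, h1, h2, h3, h4, h5, h⟩ := choose_form p h7
  refine ⟨c1, c2, h1, h2, h3, h4, h5, ?_⟩
  intro j b
  rcases le_or_gt b j with hb | hb
  · obtain ⟨d, rfl⟩ := Nat.exists_eq_add_of_le hb
    rw [h, Nat.add_sub_cancel_left]
  · rw [Nat.choose_eq_zero_of_lt hb, Nat.choose_eq_zero_of_lt (Nat.mul_lt_mul_of_pos_left hb hpf.out.pos)]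
    simp

/-- evaluation template -/
def KK (g : ℕ → ℕ → ℤ) (n k : ℕ) : ℤ :=
  ∑ j ∈ Finset.range (n + 1), (-1) ^ j * (n.choose j : ℤ) *
      ∑ a ∈ Finset.range (k + 1), ((-1) ^ a * ((n - j).choose a : ℤ)) *
        ((-1) ^ (k - a) * (j.choose (k - a) : ℤ) * g j (k - a))

/-- first weight -/
def g1 (j b : ℕ) : ℤ := xs j - (xs b + xs (j - b))
/-- second weight -/
def g2 (j b : ℕ) : ℤ := ys j - (ys b + ys (j - b))
/-- third weight -/
def g3 (j b : ℕ) : ℤ :=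
  zs j - (zs b + zs (j - b) + xs b * xs (j - b)) - (xs b + xs (j - b)) * xs j + (xs b + xs (j - b)) ^ 2

lemma kappa (h7 : 7 < p) : (p : ℤ) ∣ 12 * coeff (p * 1) (QQ p ^ 6) - 3 * coeff (p * 2) (QQ p ^ 6)
    + 2 * coeff (p * 3) (QQ p ^ 6) - 3 * coeff (p * 4) (QQ p ^ 6) + 12 * coeff (p * 5) (QQ p ^ 6)
    + 100 * coeff (p * 1) (QQ p ^ 3) ^ 2 := by
  obtain ⟨c1, c2, -, -, h3, h4, h5, h⟩ := choose_form' p h7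
  have hq := QQ_pow p (by omega) 3 1
  have k1 := QQ_pow p (by omega) 6 1
  have k2 := QQ_pow p (by omega) 6 2
  have k3 := QQ_pow p (by omega) 6 3
  have k4 := QQ_pow p (by omega) 6 4
  have k5 := QQ_pow p (by omega) 6 5
  generalize coeff (p * 1) (QQ p ^ 3) = q at *
  generalize coeff (p * 1) (QQ p ^ 6) = κ1 at *
  generalize coeff (p * 2) (QQ p ^ 6) = κ2 at *
  generalize coeff (p * 3) (QQ p ^ 6) = κ3 at *
  generalize coeff (p * 4) (QQ p ^ 6) = κ4 at *
  generalize coeff (p * 5) (QQ p ^ 6) = κ5 at *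
  have hsum : ∀ n k : ℕ, ∀ y v0 v1 v2 v3 : ℤ, KK (fun _ _ => 1) n k = v0 → KK g1 n k = v1 →
      KK g2 n k = v2 → KK g3 n k = v3 → (p : ℤ) ^ n * y =
    ∑ j ∈ Finset.range (n + 1), (-1) ^ j * (n.choose j : ℤ) *
      ∑ ab ∈ antidiagonal k, ((-1) ^ ab.1 * ((n - j).choose ab.1 : ℤ)) *
        ((-1) ^ ab.2 * ((p * j).choose (p * ab.2) : ℤ)) →
    (p : ZMod (p ^ 7)) ^ n * (y : ZMod (p ^ 7)) =
      (v0 : ZMod (p ^ 7)) + (v1 : ZMod (p ^ 7)) * c1 + (v2 : ZMod (p ^ 7)) * c2 + (v3 : ZMod (p ^ 7)) * c1 ^ 2 := by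
    rintro n k y _ _ _ _ rfl rfl rfl rfl hy
    have := congrArg (Int.cast (R := ZMod (p ^ 7))) hy
    rw [Int.cast_mul, Int.cast_pow, Int.cast_natCast] at this
    rw [this]
    simp only [Finset.Nat.sum_antidiagonal_eq_sum_range_succ_mk]
    simp only [KK, g1, g2, g3, Int.cast_sum, Int.cast_mul, Finset.sum_mul, Finset.mul_sum, ← Finset.sum_add_distrib, Int.cast_natCast, h]
    refine Finset.sum_congr rfl fun j _ => Finset.sum_congr rfl fun a _ => ?_
    push_cast
    ring
  have hq' := hsum 3 1 q (0) (6) (84) (0) rfl rfl rfl rfl hq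
  have k1' := hsum 6 1 κ1 (0) (0) (0) (0) rfl rfl rfl rfl k1
  have k2' := hsum 6 2 κ2 (0) (0) (0) (360) rfl rfl rfl rfl k2
  have k3' := hsum 6 3 κ3 (0) (0) (0) (-720) rfl rfl rfl rfl k3
  have k4' := hsum 6 4 κ4 (0) (0) (0) (360) rfl rfl rfl rfl k4
  have k5' := hsum 6 5 κ5 (0) (0) (0) (0) rfl rfl rfl rfl k5
  clear hsum hq k1 k2 k3 k4 k5
  push_cast at hq' k1' k2' k3' k4' k5'
  have hz : (((p : ℤ) ^ 6 * (12 * κ1 - 3 * κ2 + 2 * κ3 - 3 * κ4 + 12 * κ5 + 100 * q ^ 2) : ℤ) : ZMod (p ^ 7)) = 0 := by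
    push_cast
    have hq2 : (p : ZMod (p ^ 7)) ^ 6 * (q : ZMod (p ^ 7)) ^ 2 = 36 * c1 ^ 2 := by
      have : (p : ZMod (p ^ 7)) ^ 6 * (q : ZMod (p ^ 7)) ^ 2 = ((p : ZMod (p ^ 7)) ^ 3 * q) ^ 2 := by ring
      rw [this, hq']
      linear_combination 2 * 6 * 84 * h4 + 84 ^ 2 * h5
    linear_combination 12 * k1' - 3 * k2' + 2 * k3' - 3 * k4' + 12 * k5' + 100 * hq2
  rw [ZMod.intCast_zmod_eq_zero_iff_dvd] at hz
  have hp0 : (p : ℤ) ^ 6 ≠ 0 := pow_ne_zero _ (by exact_mod_cast hpf.out.ne_zero)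
  rw [Nat.cast_pow, pow_succ] at hz
  exact (mul_dvd_mul_iff_left hp0).1 hz

end comb
end S16

namespace S16
open PowerSeries

section bern
variable (p : ℕ) [hpf : Fact p.Prime]

lemma bern_int (i : ℕ) (hi : i + 1 < p) : ((bernoulli i : ℚ) : ℚ_[p]) ∈ PadicInt.subring p := by
  induction i using Nat.strong_induction_on with
  | _ i ih =>
    have h := sum_bernoulli (i + 1)
    rw [Finset.sum_range_succ, Nat.choose_succ_self_right] at h
    have h' := congrArg (Rat.cast (K := ℚ_[p])) h
    push_cast at h'
    have hnd : ¬ p ∣ i + 1 := fun hd => absurd (Nat.le_of_dvd (by omega) hd) (by omega)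
    have hu := congrArg (fun x : ℤ_[p] => (x : ℚ_[p])) (mul_pinv p hnd)
    simp only [PadicInt.coe_mul, PadicInt.coe_natCast, PadicInt.coe_one] at hu
    push_cast at hu
    have hB : ((bernoulli i : ℚ) : ℚ_[p]) = (pinv p (i + 1) : ℚ_[p]) *
        ((((if i + 1 = 1 then 1 else 0 : ℚ)) : ℚ_[p]) - ∑ x ∈ Finset.range i, (((i + 1).choose x : ℕ) : ℚ_[p]) * ((bernoulli x : ℚ) : ℚ_[p])) := by
      push_cast
      linear_combination (pinv p (i + 1) : ℚ_[p]) * h' - ((bernoulli i : ℚ) : ℚ_[p]) * hu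
    rw [hB]
    refine Subring.mul_mem _ (pinv p (i + 1)).2 (Subring.sub_mem _ ?_ (Subring.sum_mem _ fun x hx => ?_))
    · split_ifs
      · simp
      · simp
    · have : x < i := by simpa using hx
      exact Subring.mul_mem _ (natCast_mem _ _) (ih x this (by omega))

/-- the `p`-adic integer `B_i` -/
noncomputable def bz (i : ℕ) : ℤ_[p] :=
  if h : ‖((bernoulli i : ℚ) : ℚ_[p])‖ ≤ 1 then (⟨_, h⟩ : ℤ_[p]) else 0

lemma bz_coe (i : ℕ) (hi : i + 1 < p) : (bz p i : ℚ_[p]) = ((bernoulli i : ℚ) : ℚ_[p]) := by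
  have hb : ‖((bernoulli i : ℚ) : ℚ_[p])‖ ≤ 1 := bern_int p i hi
  have h : bz p i = (⟨_, hb⟩ : ℤ_[p]) := dif_pos hb
  rw [h]

lemma faul (n : ℕ) (h2 : 2 < p) : ((p : ℤ_[p]) - 1) * ∑ k ∈ Finset.range n, (k : ℤ_[p]) ^ (p - 2) =
    ∑ i ∈ Finset.range (p - 1), bz p i * ((p - 1).choose i : ℤ_[p]) * (n : ℤ_[p]) ^ (p - 1 - i) := by
  have h := sum_range_pow n (p - 2)
  have hp : p - 2 + 1 = p - 1 := by omega
  have hq : (((p - 2 : ℕ) : ℚ) + 1) = (p : ℚ) - 1 := by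
    rw [Nat.cast_sub (by omega)]; push_cast; ring
  have hne : (p : ℚ) - 1 ≠ 0 := by
    have : (2 : ℚ) < p := by exact_mod_cast h2
    linarith
  rw [hp, hq, ← Finset.sum_div, eq_div_iff hne] at h
  have h' := congrArg (Rat.cast (K := ℚ_[p])) h
  apply PadicInt.ext
  push_cast at h'
  have hL : ∀ x : ℤ_[p], (x : ℚ_[p]) = PadicInt.Coe.ringHom x := fun _ => rfl
  rw [hL, hL]
  simp only [map_mul, map_sub, map_sum, map_natCast, map_pow, map_one]
  simp only [← hL]
  rw [mul_comm, h']
  refine Finset.sum_congr rfl fun i hi => ?_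
  have : i < p - 1 := by simpa using hi
  rw [bz_coe p i (by omega)]

lemma sum_range_zmod {M : Type*} [AddCommMonoid M] (f : ZMod p → M) :
    ∑ b ∈ Finset.range p, f (b : ZMod p) = ∑ x : ZMod p, f x := by
  refine Finset.sum_nbij' (fun b => (b : ZMod p)) (fun x => x.val) ?_ ?_ ?_ ?_ ?_
  · intro a _; simp
  · intro a _; simpa using ZMod.val_lt a
  · intro a ha; exact ZMod.val_cast_of_lt (by simpa using ha)
  · intro a _; simp
  · intro a _; rfl

lemma sum_pow_zmod (h2 : 2 < p) (e : ℕ) (h1 : p - 2 ≤ e) (he : e < 2 * (p - 1)) :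
    ∑ x : ZMod p, x ^ e = if e = p - 1 then -1 else 0 := by
  have hc : Fintype.card (ZMod p) = p := ZMod.card p
  split_ifs with h
  · subst h
    have : ∀ x : ZMod p, x ^ (p - 1) = 1 - if x = 0 then 1 else 0 := by
      intro x
      split_ifs with hx
      · subst hx; rw [zero_pow (by omega)]; ring
      · rw [ZMod.pow_card_sub_one_eq_one hx]; ring
    simp only [this, Finset.sum_sub_distrib]
    simp
  · by_cases h3 : e < p - 1
    · exact FiniteField.sum_pow_lt_card_sub_one (ZMod p) e (by rw [hc]; exact h3)
    · have : ∀ x : ZMod p, x ^ e = x ^ (e - (p - 1)) := by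
        intro x
        have e1 : e = p + (e - (p - 1) - 1) := by omega
        have e2 : e - (p - 1) = 1 + (e - (p - 1) - 1) := by omega
        conv_lhs => rw [e1]
        conv_rhs => rw [e2]
        rw [pow_add, ZMod.pow_card, pow_add, pow_one]
      simp only [this]
      exact FiniteField.sum_pow_lt_card_sub_one (ZMod p) _ (by rw [hc]; omega)

lemma inv_eq_pow (h2 : 2 < p) (x : ZMod p) : x⁻¹ = x ^ (p - 2) := by
  by_cases hx : x = 0
  · subst hx; rw [zero_pow (by omega)]; simp
  · have h := ZMod.pow_card_sub_one_eq_one hx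
    have e : p - 1 = (p - 2) + 1 := by omega
    rw [e, pow_succ] at h
    exact (eq_inv_of_mul_eq_one_left h).symm

lemma harm (h7 : 7 < p) : ∑ n ∈ Finset.range p, ((n : ZMod p)⁻¹) ^ 2 * ∑ k ∈ Finset.range n, (k : ZMod p)⁻¹
    = PadicInt.toZMod (bz p (p - 3)) := by
  have hH : ∀ n : ℕ, ∑ k ∈ Finset.range n, (k : ZMod p)⁻¹ = 
      -∑ i ∈ Finset.range (p - 1), PadicInt.toZMod (bz p i) * ((p - 1).choose i : ZMod p) * (n : ZMod p) ^ (p - 1 - i) := by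
    intro n
    have h := congrArg (PadicInt.toZMod (p := p)) (faul p n (by omega))
    simp only [map_mul, map_sub, map_sum, map_natCast, map_pow, map_one, CharP.cast_eq_zero] at h
    rw [← h]
    simp only [inv_eq_pow p (by omega : 2 < p)]
    ring
  have hsq : ∀ n ∈ Finset.range p, ((n : ZMod p)⁻¹) ^ 2 * ∑ k ∈ Finset.range n, (k : ZMod p)⁻¹ = 
      -∑ i ∈ Finset.range (p - 1), PadicInt.toZMod (bz p i) * ((p - 1).choose i : ZMod p) * (n : ZMod p) ^ (2 * p - 4 - i) := by
    intro n hn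
    have hn' : n < p := by simpa using hn
    rw [hH, mul_neg, Finset.mul_sum]
    congr 1
    refine Finset.sum_congr rfl fun i hi => ?_
    have hi' : i < p - 1 := by simpa using hi
    have h2 : ((n : ZMod p)⁻¹) ^ 2 = (n : ZMod p) ^ (p - 3) := by
      by_cases hx : (n : ZMod p) = 0
      · rw [hx, zero_pow (by omega)]; simp
      · have h := ZMod.pow_card_sub_one_eq_one hx
        have e : p - 1 = (p - 3) + 2 := by omega
        rw [e, pow_add] at h
        rw [inv_pow]
        exact (eq_inv_of_mul_eq_one_left h).symm
    have e3 : 2 * p - 4 - i = (p - 3) + (p - 1 - i) := by omega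
    rw [h2, e3, pow_add]; ring
  rw [Finset.sum_congr rfl hsq, Finset.sum_neg_distrib, Finset.sum_comm]
  simp only [← Finset.mul_sum]
  have hs : ∀ i ∈ Finset.range (p - 1), PadicInt.toZMod (bz p i) * ((p - 1).choose i : ZMod p) * ∑ n ∈ Finset.range p, (n : ZMod p) ^ (2 * p - 4 - i)
     = if i = p - 3 then -(PadicInt.toZMod (bz p i) * ((p - 1).choose i : ZMod p)) else 0 := by
    intro i hi
    have hi' : i < p - 1 := by simpa using hi
    rw [sum_range_zmod p (fun x => x ^ (2 * p - 4 - i)), sum_pow_zmod p (by omega) _ (by omega) (by omega)]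
    by_cases h : i = p - 3
    · rw [if_pos (by omega), if_pos h]; ring
    · rw [if_neg (by omega), if_neg h]; ring
  rw [Finset.sum_congr rfl hs, Finset.sum_ite_eq', if_pos (by simp; omega), neg_neg]
  have hch : ((p - 1).choose (p - 3) : ZMod p) = 1 := by
    have hc : (p - 1).choose (p - 3) = (p - 1).choose 2 := by
      rw [← Nat.choose_symm (by omega : p - 3 ≤ p - 1)]; congr 1; omega
    rw [hc]
    have h := Nat.triangle_succ (p - 2)
    have hc2 : (p - 1).choose 2 * 2 = (p - 1) * (p - 2) := by
      rw [Nat.choose_two_right]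
      have : p - 1 - 1 = p - 2 := by omega
      rw [this]
      apply Nat.div_mul_cancel
      have := (Nat.even_mul_succ_self (p - 2)).two_dvd
      rwa [show p - 2 + 1 = p - 1 by omega, mul_comm] at this
    have h3 := congrArg (Nat.cast (R := ZMod p)) hc2
    rw [Nat.cast_mul, Nat.cast_mul, Nat.cast_sub (by omega : 1 ≤ p), Nat.cast_sub (by omega : 2 ≤ p)] at h3
    simp only [CharP.cast_eq_zero] at h3
    have h2 : (2 : ZMod p) ≠ 0 := by
      intro h
      have : ((2 : ℕ) : ZMod p) = 0 := by exact_mod_cast h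
      rw [ZMod.natCast_eq_zero_iff] at this
      exact absurd (Nat.le_of_dvd (by omega) this) (by omega)
    apply mul_right_cancel₀ h2
    push_cast at h3
    linear_combination h3
  rw [hch, mul_one]

end bern
end S16

namespace S16
open PowerSeries

section q3
variable (p : ℕ) [hpf : Fact p.Prime]

lemma choose_pred (m : ℕ) (hm : m < p) : ((p - 1).choose m : ZMod p) = (-1) ^ m := by
  induction m with
  | zero => simp
  | succ m ih =>
    have h := Nat.choose_succ_succ (p - 1) m
    rw [Nat.succ_eq_add_one, Nat.succ_eq_add_one, Nat.sub_add_cancel hpf.out.one_lt.le] at h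
    have hd : ((p.choose (m + 1) : ℕ) : ZMod p) = 0 :=
      (ZMod.natCast_eq_zero_iff _ _).2 (hpf.out.dvd_choose_self (by omega) hm)
    rw [h] at hd
    push_cast at hd
    rw [ih (by omega)] at hd
    rw [pow_succ]
    linear_combination hd

lemma QQ_zmod (l : ℕ) (hl : l ≤ p) : ((coeff l (QQ p) : ℤ) : ZMod p) = (l : ZMod p)⁻¹ := by
  rw [QQ, coeff_mk]
  by_cases h : 0 < l ∧ l < p
  · rw [if_pos h]
    have hl0 : (l : ZMod p) ≠ 0 := by
      intro h0
      rw [ZMod.natCast_eq_zero_iff] at h0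
      exact absurd (Nat.le_of_dvd h.1 h0) (by omega)
    apply eq_inv_of_mul_eq_one_left
    obtain ⟨m, rfl⟩ : ∃ m, l = m + 1 := ⟨l - 1, by omega⟩
    have hd : p ∣ p.choose (m + 1) := hpf.out.dvd_choose_self (by omega) h.2
    have h1 := Nat.add_one_mul_choose_eq (p - 1) m
    rw [Nat.sub_add_cancel hpf.out.one_lt.le] at h1
    have h2 : (p.choose (m + 1) / p) * (m + 1) = (p - 1).choose m := by
      apply Nat.eq_of_mul_eq_mul_left hpf.out.pos
      rw [h1, ← mul_assoc, Nat.mul_div_cancel' hd]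
    have h3 := congrArg (Nat.cast (R := ZMod p)) h2
    rw [choose_pred p m (by omega)] at h3
    rw [Int.cast_mul, Int.cast_natCast]
    generalize p.choose (m + 1) / p = y at *
    push_cast at h3 ⊢
    have h4 : ((-1 : ZMod p) ^ m) * (-1) ^ m = 1 := by
      rw [← mul_pow]; simp
    rw [pow_succ, pow_succ]
    linear_combination (-1) ^ m * h3 + h4
  · rw [if_neg h]
    rcases Nat.eq_zero_or_pos l with rfl | h0
    · simp
    · have : l = p := by omega
      subst this; simp

lemma q3_zmod (h7 : 7 < p) : ((coeff (p * 1) (QQ p ^ 3) : ℤ) : ZMod p) =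
    -2 * PadicInt.toZMod (bz p (p - 3)) := by
  set F : (ZMod p)⟦X⟧ := PowerSeries.map (Int.castRingHom (ZMod p)) (QQ p) with hF
  have hc : ∀ l, l ≤ p → coeff l F = (l : ZMod p)⁻¹ := by
    intro l hl
    rw [hF, coeff_map, eq_intCast, QQ_zmod p l hl]
  have h3 : ((coeff (p * 1) (QQ p ^ 3) : ℤ) : ZMod p) = coeff p (F ^ 2 * F) := by
    rw [← pow_succ, hF, ← map_pow, coeff_map, eq_intCast, mul_one]
  have hF2 : ∀ b, b < p → coeff b (F ^ 2) = 2 * (b : ZMod p)⁻¹ * ∑ k ∈ Finset.range b, (k : ZMod p)⁻¹ := by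
    intro b hb
    rw [pow_two, coeff_mul]
    rcases Nat.eq_zero_or_pos b with rfl | hb0
    · simp [hc 0 (by omega)]
    have hne : ∀ i, 0 < i → i < p → (i : ZMod p) ≠ 0 := by
      intro i h1 h2 h0
      rw [ZMod.natCast_eq_zero_iff] at h0
      exact absurd (Nat.le_of_dvd h1 h0) (by omega)
    have hbz := hne b hb0 hb
    rw [Finset.Nat.sum_antidiagonal_eq_sum_range_succ_mk]
    simp only
    have hterm : ∀ i ∈ Finset.range b, coeff i F * coeff (b - i) F =
        (b : ZMod p)⁻¹ * ((i : ZMod p)⁻¹ + (((b - i : ℕ) : ZMod p)⁻¹)) - if i = 0 then ((b : ZMod p)⁻¹) ^ 2 else 0 := by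
      intro i hi
      have hi' : i < b := by simpa using hi
      rw [hc i (by omega), hc (b - i) (by omega)]
      split_ifs with h0
      · subst h0; simp; ring
      · have a1 := hne i (by omega) (by omega)
        have a2 := hne (b - i) (by omega) (by omega)
        have a3 : (b : ZMod p) = (i : ZMod p) + ((b - i : ℕ) : ZMod p) := by
          rw [← Nat.cast_add]; congr 1; omega
        have a4 := hbz
        rw [a3] at a4 ⊢
        field_simp
        ring
    rw [Finset.sum_range_succ, Finset.sum_congr rfl hterm, Finset.sum_sub_distrib, ← Finset.mul_sum,
      Finset.sum_add_distrib, Finset.sum_ite_eq', if_pos (by simpa using hb0), hc b hb.le, Nat.sub_self,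
      hc 0 (by omega)]
    have hrefl : ∑ i ∈ Finset.range b, (((b - i : ℕ) : ZMod p)⁻¹) = (∑ i ∈ Finset.range b, (i : ZMod p)⁻¹) + (b : ZMod p)⁻¹ := by
      have r1 := Finset.sum_range_reflect (fun j => (((j + 1 : ℕ) : ZMod p))⁻¹) b
      have r2 := Finset.sum_range_succ (fun j => ((j : ZMod p))⁻¹) b
      have r3 := Finset.sum_range_succ' (fun j => ((j : ZMod p))⁻¹) b
      rw [← r2, r3, ← r1]
      simp only [Nat.cast_zero, inv_zero, add_zero]
      refine Finset.sum_congr rfl fun i hi => ?_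
      have hi' : i < b := by simpa using hi
      congr 2; omega
    rw [hrefl]
    simp
    ring
  rw [h3, coeff_mul, Finset.Nat.sum_antidiagonal_eq_sum_range_succ_mk, Finset.sum_range_succ]
  simp only
  rw [Nat.sub_self, hc 0 (by omega), ← harm p h7, Finset.mul_sum]
  simp only [Nat.cast_zero, inv_zero, mul_zero, add_zero]
  refine Finset.sum_congr rfl fun n hn => ?_
  have hn' : n < p := by simpa using hn
  rw [hF2 n hn', hc (p - n) (by omega), Nat.cast_sub hn'.le]
  simp only [CharP.cast_eq_zero, zero_sub, inv_neg]
  ring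

lemma Sk_cong (k : ℕ) : (PadicInt.toZMod (Sk p p k) : ZMod p) = ((coeff (p * k) (QQ p ^ 6) : ℤ) : ZMod p) := by
  have h : PowerSeries.map (PadicInt.toZMod (p := p)) (fr p p) = PowerSeries.map (Int.castRingHom (ZMod p)) (QQ p) := by
    ext l
    rw [coeff_map, coeff_map, eq_intCast, fr, coeff_mk]
    by_cases hl : l < p ∧ ¬ p ∣ l
    · rw [if_pos hl, QQ_zmod p l hl.1.le]
      have := congrArg (PadicInt.toZMod (p := p)) (mul_pinv p hl.2)
      rw [map_mul, map_natCast, map_one] at this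
      exact eq_inv_of_mul_eq_one_right this
    · rw [if_neg hl, QQ, coeff_mk, if_neg]
      · simp
      · rintro ⟨h1, h2⟩
        exact hl ⟨h2, fun hd => absurd (Nat.le_of_dvd h1 hd) (by omega)⟩
  rw [Sk, ← coeff_map, map_pow, h, ← map_pow, coeff_map, eq_intCast]

lemma Dl_cong (h7 : 7 < p) : (p : ℤ_[p]) ∣ Dl p p + 400 * bz p (p - 3) ^ 2 := by
  have hk := kappa p h7
  have hk' := (ZMod.intCast_zmod_eq_zero_iff_dvd _ p).2 hk
  push_cast at hk'
  rw [q3_zmod p h7] at hk'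
  simp only [← Sk_cong] at hk'
  have h : PadicInt.toZMod (Dl p p + 400 * bz p (p - 3) ^ 2) = 0 := by
    simp only [Dl, map_add, map_sub, map_mul, map_pow, map_ofNat]
    linear_combination hk'
  have h2 : Dl p p + 400 * bz p (p - 3) ^ 2 ∈ RingHom.ker (PadicInt.toZMod (p := p)) := h
  rw [PadicInt.ker_toZMod, PadicInt.maximalIdeal_eq_span_p, Ideal.mem_span_singleton] at h2
  exact h2

end q3
end S16

namespace S16
open PowerSeries

section fin
variable (p : ℕ) [hpf : Fact p.Prime]

lemma fQ_fR (N : ℕ) : ((coeff N (fQ p ^ 6) : ℚ) : ℚ_[p]) = (ZR p N : ℚ_[p]) := by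
  have h : PowerSeries.map (algebraMap ℚ ℚ_[p]) (fQ p) = PowerSeries.map (PadicInt.Coe.ringHom (p := p)) (fR p) := by
    ext l
    rw [coeff_map, coeff_map, fQ, fR, coeff_mk, coeff_mk]
    by_cases hd : p ∣ l
    · rw [if_neg (by tauto), if_pos hd, map_zero, map_zero]
    · have hl : 0 < l := Nat.pos_of_ne_zero (by rintro rfl; exact hd (dvd_zero p))
      rw [if_pos ⟨hl, hd⟩, if_neg hd]
      have h1 := congrArg (PadicInt.Coe.ringHom (p := p)) (mul_pinv p hd)
      rw [map_mul, map_natCast, map_one] at h1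
      rw [map_inv₀, map_natCast]
      exact (eq_inv_of_mul_eq_one_right h1).symm
  have h2 : ((coeff N (fQ p ^ 6) : ℚ) : ℚ_[p]) = coeff N (PowerSeries.map (algebraMap ℚ ℚ_[p]) (fQ p) ^ 6) := by
    rw [← map_pow, coeff_map]; rfl
  rw [h2, h, ← map_pow, coeff_map]
  rfl

lemma final (h7 : 7 < p) (r : ℕ) (hr : 2 ≤ r) (E : ℚ)
    (hE : E = (1 / 2 * coeff (p ^ r) (fQ p ^ 6) - coeff (2 * p ^ r) (fQ p ^ 6))
      - 10 * bernoulli (p - 3) ^ 2 * (p : ℚ) ^ (r - 1)) :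
    E = 0 ∨ (r : ℤ) ≤ padicValRat p E := by
  by_cases h0 : E = 0
  · exact Or.inl h0
  right
  obtain ⟨a, ha⟩ := main_red p h7 r hr 1
  obtain ⟨b, hb⟩ := main_red p h7 r hr 2
  obtain ⟨c, hc⟩ := Dl_cong p h7
  have hpr : (p : ℤ_[p]) ^ r = (p : ℤ_[p]) ^ (r - 1) * p := by
    rw [← pow_succ]; congr 1; omega
  have hz : 60 * (ZR p (p ^ r * 1) - 2 * ZR p (p ^ r * 2)) - 1200 * bz p (p - 3) ^ 2 * (p : ℤ_[p]) ^ (r - 1)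
      = (p : ℤ_[p]) ^ r * (a - 2 * b - 3 * c) := by
    push_cast at ha hb
    linear_combination ha - 2 * hb - 3 * (p : ℤ_[p]) ^ (r - 1) * hc + 3 * c * hpr
  have hE2 : ((120 * E : ℚ) : ℚ_[p]) = (((p : ℤ_[p]) ^ r * (a - 2 * b - 3 * c) : ℤ_[p]) : ℚ_[p]) := by
    rw [← hz, hE]
    have e1 := fQ_fR p (p ^ r)
    have e2 := fQ_fR p (2 * p ^ r)
    have e3 := bz_coe p (p - 3) (by omega)
    rw [mul_one, mul_comm (p ^ r) 2]
    have hL : ∀ x : ℤ_[p], (x : ℚ_[p]) = PadicInt.Coe.ringHom x := fun _ => rfl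
    rw [hL]
    simp only [map_mul, map_sub, map_natCast, map_pow, map_ofNat]
    simp only [← hL]
    rw [← e1, ← e2, e3]
    push_cast
    ring
  have hn : ‖((120 * E : ℚ) : ℚ_[p])‖ ≤ (p : ℝ) ^ (-(r : ℤ)) := by
    rw [hE2, ← PadicInt.norm_def, PadicInt.norm_le_pow_iff_mem_span_pow, Ideal.mem_span_singleton]
    exact Dvd.intro _ rfl
  have h120 : padicValRat p 120 = 0 := by
    have : padicValRat p ((120 : ℕ) : ℚ) = 0 := by
      rw [padicValRat.of_nat, padicValNat.eq_zero_of_not_dvd]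
      · rfl
      · intro hd
        have : (120 : ℕ) = 2 ^ 3 * 3 * 5 := by norm_num
        rw [this] at hd
        rcases (hpf.out.dvd_mul).1 hd with h | h
        · rcases (hpf.out.dvd_mul).1 h with h | h
          · exact absurd (Nat.le_of_dvd (by omega) (hpf.out.dvd_of_dvd_pow h)) (by omega)
          · exact absurd (Nat.le_of_dvd (by omega) h) (by omega)
        · exact absurd (Nat.le_of_dvd (by omega) h) (by omega)
    exact_mod_cast this
  have hne : (120 * E : ℚ) ≠ 0 := mul_ne_zero (by norm_num) h0
  rw [Padic.eq_padicNorm, padicNorm.eq_zpow_of_nonzero hne] at hn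
  push_cast at hn
  have hp1 : (1 : ℝ) < p := by exact_mod_cast hpf.out.one_lt
  rw [zpow_le_zpow_iff_right₀ hp1] at hn
  rw [padicValRat.mul (by norm_num) h0, h120] at hn
  omega

end fin
end S16

theorem stmt16 (r : ℕ) (hr : 2 ≤ r) (p : ℕ) (hp : p.Prime) (hp7 : 7 < p) :
    padicCong p r
      (6 * sigmaSum p 6 1 (2 * p ^ r) + 15 * sigmaSum p 6 2 (2 * p ^ r) +
        10 * sigmaSum p 6 3 (2 * p ^ r))
      (10 * bernoulli (p - 3) ^ 2 * (p : ℚ) ^ (r - 1)) := by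
  haveI : Fact p.Prime := ⟨hp⟩
  rw [S16.lhs_eq p hp (by omega) (p ^ r)]
  rcases S16.final p hp7 r hr _ rfl with h | h
  · exact Or.inl (sub_eq_zero.1 h)
  · exact Or.inr h
end
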